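/- Let d ≥ 2, let X = {x₀,…,x_d} be an affine basis of ℝ^d and δ a metric on X. Then there exists a Lipschitz potential W : ℝ^d → [0,∞) such that W(z) = 1 for |z| large enough, X = W^{-1}({0}), geod_W = δ on X×X, and for every u^± ∈ X, every ν ∈ S^{d-1} with ν·(u^+−u^-) = 0 and every R ∈ SO(d) with Rν = e₁: if u ∈ Ḣ¹_div(Ω_R,ℝ^d) is a global minimizer of E_R over divergence-free configurations with the rotated boundary condition, then u is one-dimensional, i.e. u = g(x·ν) where g ∈ Ḣ¹(ℝ,ℝ^d), g(±∞) = u^±, and E_R(u) = δ(u^-,u^+). -/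

import Mathlib

open MeasureTheory Filter Topology ENNReal

noncomputable section

/-- Squared Euclidean norm on `ℝ^d` (modelled as `Fin d → ℝ`). -/
def vnorm2 {d : ℕ} (v : Fin d → ℝ) : ℝ := ∑ i, v i ^ 2

/-- Partial derivative in the `i`-th coordinate direction of a map `ℝ^d → ℝ^d`. -/
def pd {d : ℕ} (i : Fin d) (u : (Fin d → ℝ) → Fin d → ℝ) (x : Fin d → ℝ) : Fin d → ℝ :=
  fderiv ℝ u x (Pi.single i 1)

/-- Partial derivative in the `i`-th coordinate direction of a scalar function on `ℝ^d`. -/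
def pdS {d : ℕ} (i : Fin d) (w : (Fin d → ℝ) → ℝ) (x : Fin d → ℝ) : ℝ :=
  fderiv ℝ w x (Pi.single i 1)

/-- Squared Frobenius norm `|∇u|²` of the Jacobian of `u`. -/
def gradSq {d : ℕ} (u : (Fin d → ℝ) → Fin d → ℝ) (x : Fin d → ℝ) : ℝ :=
  ∑ i, ∑ j, (pd i u x j) ^ 2

/-- Divergence-free condition `∇ ⋅ u = 0`. -/
def IsDivFree {d : ℕ} (u : (Fin d → ℝ) → Fin d → ℝ) : Prop :=
  ∀ x, ∑ i, pd i u x i = 0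

/-- Periodicity (period 1) in the last `d-1` coordinates: `u` is a map on `Ω = ℝ × 𝕋^{d-1}`. -/
def IsPeriodic {d : ℕ} [NeZero d] (u : (Fin d → ℝ) → Fin d → ℝ) : Prop :=
  ∀ (x : Fin d → ℝ) (i : Fin d), i ≠ 0 → u (x + Pi.single i 1) = u x

/-- Fundamental domain `ℝ × [0,1)^{d-1}` of `Ω = ℝ × 𝕋^{d-1}`. -/
def strip (d : ℕ) [NeZero d] : Set (Fin d → ℝ) :=
  {x | ∀ i : Fin d, i ≠ 0 → x i ∈ Set.Ico (0 : ℝ) 1}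

/-- The unit cube `[0,1)^d`. -/
def cube (d : ℕ) : Set (Fin d → ℝ) := Set.univ.pi fun _ => Set.Ico (0 : ℝ) 1

/-- The `x'`-average `ū(t) = ∫_{𝕋^{d-1}} u(t,x') dx'`. -/
def avg {d : ℕ} [NeZero d] (u : (Fin d → ℝ) → Fin d → ℝ) (t : ℝ) : Fin d → ℝ :=
  ∫ y in cube d, u (Function.update y 0 t)

/-- Energy density `½|∇u|² + W(u)`. -/
def eden {d : ℕ} (W : (Fin d → ℝ) → ℝ) (u : (Fin d → ℝ) → Fin d → ℝ) (x : Fin d → ℝ) : ℝ :=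
  (1 / 2) * gradSq u x + W (u x)

/-- Total energy `E(u)` on `Ω`, with values in `[0,∞]`. -/
def energy (d : ℕ) [NeZero d] (W : (Fin d → ℝ) → ℝ) (u : (Fin d → ℝ) → Fin d → ℝ) : ℝ≥0∞ :=
  ∫⁻ x in strip d, ENNReal.ofReal (eden W u x)

/-- Membership in `Ḣ¹_div(Ω, ℝ^d)` (with classical derivatives). -/
def Adm (d : ℕ) [NeZero d] (u : (Fin d → ℝ) → Fin d → ℝ) : Prop :=
  Differentiable ℝ u ∧ IsPeriodic u ∧ IsDivFree u ∧ IntegrableOn (gradSq u) (strip d)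

/-- The boundary conditions `ū(-∞) = u⁻`, `ū(+∞) = u⁺`. -/
def BdryCond (d : ℕ) [NeZero d] (u : (Fin d → ℝ) → Fin d → ℝ) (um up : Fin d → ℝ) : Prop :=
  Tendsto (avg u) atBot (𝓝 um) ∧ Tendsto (avg u) atTop (𝓝 up)

/-- `S_a`: the zeros of `W` in the hyperplane `{z₁ = a}`. -/
def wellSet (d : ℕ) [NeZero d] (W : (Fin d → ℝ) → ℝ) (a : ℝ) : Set (Fin d → ℝ) :=
  {z | z 0 = a ∧ W z = 0}

/-- Hypothesis (H2): `liminf_{z₁ → a, |z'| → ∞} W(z₁,z') > 0`. -/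
def H2cond (d : ℕ) [NeZero d] (W : (Fin d → ℝ) → ℝ) (a : ℝ) : Prop :=
  ∃ c > (0 : ℝ), ∃ δ > (0 : ℝ), ∃ R : ℝ, ∀ z : Fin d → ℝ,
    |z 0 - a| < δ → R ≤ ∑ i, (if i = (0 : Fin d) then 0 else z i ^ 2) → c ≤ W z

/-- Geodesic (pseudo-)distance in `ℝ^d` for the degenerate metric `2 F g₀`: infimum of
`∫_{-1}^{1} √(2F(γ)) |γ̇| dt` over Lipschitz curves joining `x` to `y`. -/
def geodFull (d : ℕ) (F : (Fin d → ℝ) → ℝ) (x y : Fin d → ℝ) : ℝ :=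
  sInf {L | ∃ γ : ℝ → Fin d → ℝ, (∃ K : NNReal, LipschitzWith K γ) ∧
    γ (-1) = x ∧ γ 1 = y ∧
    L = ∫ t in Set.Icc (-1 : ℝ) 1, Real.sqrt (2 * F (γ t)) * Real.sqrt (vnorm2 (deriv γ t))}

/-- Periodicity in the rotated directions `R⁻¹e_k = Rᵀe_k`, `k = 2,…,d`: `u` is a map on the
rotated cylinder `Ω_R = R⁻¹Ω`. -/
def IsPeriodicR (d : ℕ) [NeZero d] (R : Matrix (Fin d) (Fin d) ℝ)
    (u : (Fin d → ℝ) → Fin d → ℝ) : Prop :=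
  ∀ (x : Fin d → ℝ) (i : Fin d), i ≠ 0 → u (x + R.transpose.mulVec (Pi.single i 1)) = u x

/-- Fundamental domain of the rotated cylinder `Ω_R = R⁻¹Ω`. -/
def stripR (d : ℕ) [NeZero d] (R : Matrix (Fin d) (Fin d) ℝ) : Set (Fin d → ℝ) :=
  {x | R.mulVec x ∈ strip d}

/-- The energy `E_R` on the rotated cylinder `Ω_R`. -/
def energyR (d : ℕ) [NeZero d] (W : (Fin d → ℝ) → ℝ) (R : Matrix (Fin d) (Fin d) ℝ)
    (u : (Fin d → ℝ) → Fin d → ℝ) : ℝ≥0∞ :=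
  ∫⁻ x in stripR d R, ENNReal.ofReal (eden W u x)

/-- The average of `u` over the rotated torus slice `{x ∈ Ω_R : x ⬝ ν = t}`. -/
def avgR (d : ℕ) [NeZero d] (R : Matrix (Fin d) (Fin d) ℝ)
    (u : (Fin d → ℝ) → Fin d → ℝ) (t : ℝ) : Fin d → ℝ :=
  ∫ y in cube d, u (R.transpose.mulVec (Function.update y 0 t))

/-- Membership in `Ḣ¹_div(Ω_R, ℝ^d)`. -/
def AdmR (d : ℕ) [NeZero d] (R : Matrix (Fin d) (Fin d) ℝ)
    (u : (Fin d → ℝ) → Fin d → ℝ) : Prop :=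
  Differentiable ℝ u ∧ IsPeriodicR d R u ∧ IsDivFree u ∧ IntegrableOn (gradSq u) (stripR d R)

/-! ### The Euclidean norm -/

theorem vnorm2_nonneg {d : ℕ} (v : Fin d → ℝ) : 0 ≤ vnorm2 v :=
  Finset.sum_nonneg fun _ _ => sq_nonneg _

theorem vnorm2_eq_zero {d : ℕ} {v : Fin d → ℝ} : vnorm2 v = 0 ↔ v = 0 := by
  unfold vnorm2
  rw [Finset.sum_eq_zero_iff_of_nonneg fun _ _ => sq_nonneg _]
  simp [funext_iff]

theorem vnorm2_eq_dotProduct {d : ℕ} (v : Fin d → ℝ) : vnorm2 v = v ⬝ᵥ v := by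
  simp [vnorm2, dotProduct, sq]

theorem vnorm2_smul {d : ℕ} (c : ℝ) (v : Fin d → ℝ) : vnorm2 (c • v) = c ^ 2 * vnorm2 v := by
  simp [vnorm2, mul_pow, Finset.mul_sum]

theorem vnorm2_add {d : ℕ} (v w : Fin d → ℝ) :
    vnorm2 (v + w) = vnorm2 v + 2 * (v ⬝ᵥ w) + vnorm2 w := by
  simp only [vnorm2_eq_dotProduct, add_dotProduct, dotProduct_add, dotProduct_comm w v]
  ring

theorem sq_le_vnorm2 {d : ℕ} (v : Fin d → ℝ) (i : Fin d) : v i ^ 2 ≤ vnorm2 v :=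
  Finset.single_le_sum (f := fun i => v i ^ 2) (fun _ _ => sq_nonneg _) (Finset.mem_univ i)

theorem norm_sq_le_vnorm2 {d : ℕ} (v : Fin d → ℝ) : ‖v‖ ^ 2 ≤ vnorm2 v := by
  have h : ‖v‖ ≤ Real.sqrt (vnorm2 v) := by
    refine (pi_norm_le_iff_of_nonneg (Real.sqrt_nonneg _)).2 fun i => ?_
    rw [Real.norm_eq_abs]
    exact Real.abs_le_sqrt (sq_le_vnorm2 v i)
  calc ‖v‖ ^ 2 ≤ Real.sqrt (vnorm2 v) ^ 2 := by gcongr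
    _ = vnorm2 v := Real.sq_sqrt (vnorm2_nonneg v)

theorem dotProduct_sq_le {d : ℕ} (v w : Fin d → ℝ) : (v ⬝ᵥ w) ^ 2 ≤ vnorm2 v * vnorm2 w :=
  Finset.sum_mul_sq_le_sq_mul_sq _ _ _

theorem contDiff_vnorm2 {d : ℕ} : ContDiff ℝ 1 (vnorm2 : (Fin d → ℝ) → ℝ) := by
  unfold vnorm2
  fun_prop

/-! ### The smooth step -/

/-- The projection of `ℝ` onto `[0, 1]`. -/
def clamp01 (s : ℝ) : ℝ := max 0 (min 1 s)

theorem clamp01_nonneg (s : ℝ) : 0 ≤ clamp01 s := le_max_left _ _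

theorem clamp01_le_one (s : ℝ) : clamp01 s ≤ 1 := max_le zero_le_one (min_le_left _ _)

theorem clamp01_of_mem {s : ℝ} (h0 : 0 ≤ s) (h1 : s ≤ 1) : clamp01 s = s := by
  simp [clamp01, h0, h1]

theorem clamp01_one_sub (s : ℝ) : clamp01 (1 - s) = 1 - clamp01 s := by
  unfold clamp01
  rcases le_total s 0 with h | h <;> rcases le_total s 1 with h' | h' <;>
    simp [h, h'] <;> linarith

theorem clamp01_sq_le (s : ℝ) : clamp01 s ^ 2 ≤ s ^ 2 := by
  unfold clamp01
  rcases le_total s 0 with h | h <;> rcases le_total s 1 with h' | h' <;>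
    simp [h, h', -one_le_sq_iff_one_le_abs] <;> nlinarith

theorem lipschitzWith_clamp01 : LipschitzWith 1 clamp01 :=
  (LipschitzWith.id.const_min 1).const_max 0

/-- The distance from `s` to `clamp01 s` is minimal among points of `[0, 1]`. -/
theorem sub_clamp01_sq_le (s : ℝ) {c : ℝ} (h0 : 0 ≤ c) (h1 : c ≤ 1) :
    (s - clamp01 s) ^ 2 ≤ (s - c) ^ 2 := by
  unfold clamp01
  rcases le_total s 0 with h | h <;> rcases le_total s 1 with h' | h' <;>
    simp [h, h'] <;> nlinarith

/-- The cubic Hermite step. -/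
def hermite (s : ℝ) : ℝ := 3 * clamp01 s ^ 2 - 2 * clamp01 s ^ 3

/-- The derivative of the cubic Hermite step. -/
def hermiteDeriv (s : ℝ) : ℝ := 6 * (clamp01 s * (1 - clamp01 s))

theorem hermite_nonneg (s : ℝ) : 0 ≤ hermite s := by
  have h0 := clamp01_nonneg s
  have h1 := clamp01_le_one s
  unfold hermite
  nlinarith [mul_nonneg (sq_nonneg (clamp01 s)) (sub_nonneg.2 h1)]

theorem hermite_one_sub (s : ℝ) : hermite (1 - s) = 1 - hermite s := by
  simp only [hermite, clamp01_one_sub]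
  ring

theorem hermite_le_one (s : ℝ) : hermite s ≤ 1 := by
  have := hermite_nonneg (1 - s)
  rw [hermite_one_sub] at this
  linarith

theorem hermiteDeriv_one_sub (s : ℝ) : hermiteDeriv (1 - s) = hermiteDeriv s := by
  simp only [hermiteDeriv, clamp01_one_sub]
  ring

theorem hermite_le_sq (s : ℝ) : hermite s ≤ 3 * s ^ 2 := by
  have h0 := clamp01_nonneg s
  have := clamp01_sq_le s
  unfold hermite
  nlinarith [pow_nonneg h0 3]

theorem hermiteDeriv_sq_le (s : ℝ) : hermiteDeriv s ^ 2 ≤ 36 * s ^ 2 := by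
  have h0 := clamp01_nonneg s
  have h1 := clamp01_le_one s
  have h2 := clamp01_sq_le s
  have : (1 - clamp01 s) ^ 2 ≤ 1 := by nlinarith
  have h3 : clamp01 s ^ 2 * (1 - clamp01 s) ^ 2 ≤ clamp01 s ^ 2 * 1 := by gcongr
  unfold hermiteDeriv
  nlinarith

theorem hermiteDeriv_sq_le_const (s : ℝ) : hermiteDeriv s ^ 2 ≤ 36 := by
  have h0 := clamp01_nonneg s
  have h1 := clamp01_le_one s
  have h2 : 0 ≤ clamp01 s * (1 - clamp01 s) := mul_nonneg h0 (by linarith)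
  have h3 : clamp01 s * (1 - clamp01 s) ≤ 1 := by nlinarith
  unfold hermiteDeriv
  nlinarith

theorem hermite_eq_zero {s : ℝ} (h : hermite s = 0) : clamp01 s = 0 := by
  have h0 := clamp01_nonneg s
  have h1 := clamp01_le_one s
  unfold hermite at h
  have : clamp01 s ^ 2 * (3 - 2 * clamp01 s) = 0 := by linarith
  rcases mul_eq_zero.1 this with h | h
  · simpa using h
  · linarith

theorem hermite_eq_one {s : ℝ} (h : hermite s = 1) : clamp01 s = 1 := by
  have : hermite (1 - s) = 0 := by rw [hermite_one_sub, h, sub_self]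
  have := hermite_eq_zero this
  rw [clamp01_one_sub] at this
  linarith

theorem hermite_sub_le (x y : ℝ) :
    |hermite y - hermite x - hermiteDeriv x * (y - x)| ≤ 6 * (y - x) ^ 2 := by
  unfold hermite hermiteDeriv
  have key : ∀ a b : ℝ, 0 ≤ a → a ≤ 1 → 0 ≤ b → b ≤ 1 →
      |3 * b ^ 2 - 2 * b ^ 3 - (3 * a ^ 2 - 2 * a ^ 3) - 6 * (a * (1 - a)) * (b - a)|
        ≤ 6 * (b - a) ^ 2 := by
    intro a b ha0 ha1 hb0 hb1
    have : 3 * b ^ 2 - 2 * b ^ 3 - (3 * a ^ 2 - 2 * a ^ 3) - 6 * (a * (1 - a)) * (b - a)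
        = (3 - 4 * a - 2 * b) * (b - a) ^ 2 := by ring
    rw [this, abs_mul, abs_of_nonneg (sq_nonneg (b - a))]
    refine mul_le_mul_of_nonneg_right ?_ (sq_nonneg _)
    rw [abs_le]
    constructor <;> linarith
  have hb0 := clamp01_nonneg y
  have hb1 := clamp01_le_one y
  have ha0 := clamp01_nonneg x
  have ha1 := clamp01_le_one x
  have hlip : (clamp01 y - clamp01 x) ^ 2 ≤ (y - x) ^ 2 := by
    have := lipschitzWith_clamp01.dist_le_mul y x
    simp only [NNReal.coe_one, one_mul, Real.dist_eq] at this
    exact sq_le_sq.2 this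
  have h := key _ _ ha0 ha1 hb0 hb1
  rcases le_total x 0 with hx | hx
  · have : clamp01 x = 0 := by simp [clamp01, hx]
    rw [this] at h hlip ⊢
    simp only [zero_mul, mul_zero] at h ⊢
    linarith
  rcases le_total 1 x with hx' | hx'
  · have : clamp01 x = 1 := by simp [clamp01, hx']
    rw [this] at h hlip ⊢
    simp only [sub_self, zero_mul, mul_zero] at h ⊢
    linarith
  have hxx : clamp01 x = x := clamp01_of_mem hx hx'
  rw [hxx] at h hlip ⊢
  rcases le_total y 0 with hy | hy
  · have : clamp01 y = 0 := by simp [clamp01, hy]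
    rw [this, abs_le]
    constructor <;> nlinarith [mul_nonneg hx (sub_nonneg.2 hx'),
      mul_nonneg (mul_nonneg hx (sub_nonneg.2 hx')) (neg_nonneg.2 hy),
      mul_nonneg hx (neg_nonneg.2 hy), mul_nonneg hx hx,
      mul_nonneg (mul_nonneg hx hx) (sub_nonneg.2 hx')]
  rcases le_total 1 y with hy' | hy'
  · have : clamp01 y = 1 := by simp [clamp01, hy']
    rw [this, abs_le]
    have e1 := sub_nonneg.2 hx'
    have e2 := sub_nonneg.2 hy'
    constructor <;> nlinarith [mul_nonneg hx e1, mul_nonneg (mul_nonneg hx e1) e2,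
      mul_nonneg e1 e2, mul_nonneg e1 e1, mul_nonneg (mul_nonneg e1 e1) hx]
  rwa [clamp01_of_mem hy hy'] at h ⊢

theorem hasDerivAt_hermite (s : ℝ) : HasDerivAt hermite (hermiteDeriv s) s := by
  rw [hasDerivAt_iff_isLittleO]
  have : (fun y => hermite y - hermite s - (y - s) • hermiteDeriv s)
      =O[𝓝 s] fun y => (y - s) ^ 2 := by
    refine Asymptotics.IsBigO.of_bound 6 (Eventually.of_forall fun y => ?_)
    rw [Real.norm_eq_abs, Real.norm_eq_abs, abs_of_nonneg (sq_nonneg (y - s)), smul_eq_mul,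
      mul_comm (y - s)]
    exact hermite_sub_le s y
  refine this.trans_isLittleO ?_
  simpa [Real.norm_eq_abs, sq_abs] using Asymptotics.isLittleO_pow_sub_sub s one_lt_two

/-! ### Quadratic wells around a segment -/

/-- The affine coordinate along the segment `[x, y]` of the orthogonal projection of `z`. -/
def segCoord {d : ℕ} (x y z : Fin d → ℝ) : ℝ := ((z - x) ⬝ᵥ (y - x)) / vnorm2 (y - x)

/-- The point of the segment `[x, y]` closest to `z`. -/
def segFoot {d : ℕ} (x y z : Fin d → ℝ) : Fin d → ℝ :=
  x + clamp01 (segCoord x y z) • (y - x)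

/-- The squared distance to the segment `[x, y]`. -/
def segDist2 {d : ℕ} (x y z : Fin d → ℝ) : ℝ := vnorm2 (z - segFoot x y z)

/-- Interpolation between `a` and `b` along the segment `[x, y]`. -/
def segVal {d : ℕ} (a b : ℝ) (x y z : Fin d → ℝ) : ℝ := a + (b - a) * hermite (segCoord x y z)

/-- Interpolation along a segment plus a quadratic well around it. -/
def segWell {d : ℕ} (M a b : ℝ) (x y z : Fin d → ℝ) : ℝ :=
  segVal a b x y z + M * segDist2 x y z

/-- The squared slope along the segment `[x, y]` of an interpolation with increment `r`. -/
def segSlope2 {d : ℕ} (r : ℝ) (x y z : Fin d → ℝ) : ℝ :=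
  (r * hermiteDeriv (segCoord x y z)) ^ 2 / vnorm2 (y - x)

theorem segDist2_nonneg {d : ℕ} (x y z : Fin d → ℝ) : 0 ≤ segDist2 x y z := vnorm2_nonneg _

theorem segSlope2_nonneg {d : ℕ} (r : ℝ) (x y z : Fin d → ℝ) : 0 ≤ segSlope2 r x y z :=
  div_nonneg (sq_nonneg _) (vnorm2_nonneg _)

theorem vnorm2_sub_pos {d : ℕ} {x y : Fin d → ℝ} (h : x ≠ y) : 0 < vnorm2 (y - x) :=
  lt_of_le_of_ne (vnorm2_nonneg _) fun h0 => h (sub_eq_zero.1 (vnorm2_eq_zero.1 h0.symm)).symm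

theorem segCoord_swap {d : ℕ} {x y : Fin d → ℝ} (h : x ≠ y) (z : Fin d → ℝ) :
    segCoord y x z = 1 - segCoord x y z := by
  have h1 := vnorm2_sub_pos h
  have e : vnorm2 (x - y) = vnorm2 (y - x) := by
    rw [← neg_sub y x, ← neg_one_smul ℝ, vnorm2_smul]; norm_num
  unfold segCoord
  rw [e, eq_sub_iff_add_eq, ← add_div, div_eq_one_iff_eq h1.ne', vnorm2_eq_dotProduct]
  simp only [sub_dotProduct, dotProduct_sub]
  ring

theorem segFoot_swap {d : ℕ} (x y z : Fin d → ℝ) : segFoot y x z = segFoot x y z := by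
  by_cases h : x = y
  · rw [h]
  · unfold segFoot
    rw [segCoord_swap h, clamp01_one_sub]
    module

theorem segDist2_swap {d : ℕ} (x y z : Fin d → ℝ) : segDist2 y x z = segDist2 x y z := by
  unfold segDist2; rw [segFoot_swap]

theorem segVal_swap {d : ℕ} (a b : ℝ) {x y : Fin d → ℝ} (h : x ≠ y) (z : Fin d → ℝ) :
    segVal b a y x z = segVal a b x y z := by
  unfold segVal
  rw [segCoord_swap h, hermite_one_sub]
  ring

theorem segSlope2_swap {d : ℕ} (r : ℝ) (x y z : Fin d → ℝ) :
    segSlope2 r y x z = segSlope2 r x y z := by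
  by_cases h : x = y
  · rw [h]
  unfold segSlope2
  rw [segCoord_swap h, hermiteDeriv_one_sub, ← neg_sub y x, ← neg_one_smul ℝ, vnorm2_smul]
  norm_num

theorem segCoord_lineMap {d : ℕ} {x y : Fin d → ℝ} (h : x ≠ y) (t : ℝ) :
    segCoord x y (x + t • (y - x)) = t := by
  unfold segCoord
  rw [add_sub_cancel_left, smul_dotProduct, ← vnorm2_eq_dotProduct, smul_eq_mul,
    mul_div_cancel_right₀ _ (vnorm2_sub_pos h).ne']

theorem segDist2_lineMap {d : ℕ} {x y : Fin d → ℝ} (h : x ≠ y) {t : ℝ} (h0 : 0 ≤ t) (h1 : t ≤ 1) :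
    segDist2 x y (x + t • (y - x)) = 0 := by
  unfold segDist2 segFoot
  rw [segCoord_lineMap h, clamp01_of_mem h0 h1, sub_self]
  simp [vnorm2]

theorem vnorm2_sub_point {d : ℕ} (x y z : Fin d → ℝ) (c : ℝ) :
    vnorm2 (z - (x + c • (y - x))) = vnorm2 (z - (x + segCoord x y z • (y - x))) +
      (segCoord x y z - c) ^ 2 * vnorm2 (y - x) := by
  have e : z - (x + c • (y - x)) =
      (z - (x + segCoord x y z • (y - x))) + (segCoord x y z - c) • (y - x) := by module
  have ho : (z - (x + segCoord x y z • (y - x))) ⬝ᵥ (y - x) = 0 := by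
    rw [← sub_sub, sub_dotProduct, smul_dotProduct, ← vnorm2_eq_dotProduct, smul_eq_mul]
    unfold segCoord
    by_cases h : vnorm2 (y - x) = 0
    · rw [vnorm2_eq_zero.1 h]; simp
    · rw [div_mul_cancel₀ _ h, sub_self]
  rw [e, vnorm2_add, dotProduct_smul, ho, vnorm2_smul]
  simp

theorem segDist2_le {d : ℕ} (x y z : Fin d → ℝ) {c : ℝ} (h0 : 0 ≤ c) (h1 : c ≤ 1) :
    segDist2 x y z ≤ vnorm2 (z - (x + c • (y - x))) := by
  unfold segDist2 segFoot
  rw [vnorm2_sub_point x y z c, vnorm2_sub_point x y z (clamp01 _)]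
  have := mul_le_mul_of_nonneg_right (sub_clamp01_sq_le (segCoord x y z) h0 h1)
    (vnorm2_nonneg (y - x))
  linarith

theorem hermiteDeriv_mul_sub_segFoot {d : ℕ} (x y z : Fin d → ℝ) :
    hermiteDeriv (segCoord x y z) * ((z - segFoot x y z) ⬝ᵥ (y - x)) = 0 := by
  have ho : (z - segFoot x y z) ⬝ᵥ (y - x) =
      (segCoord x y z - clamp01 (segCoord x y z)) * vnorm2 (y - x) := by
    unfold segFoot
    rw [← sub_sub, sub_dotProduct, smul_dotProduct, ← vnorm2_eq_dotProduct, smul_eq_mul, sub_mul]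
    congr 1
    unfold segCoord
    by_cases h : vnorm2 (y - x) = 0
    · rw [vnorm2_eq_zero.1 h]; simp
    · rw [div_mul_cancel₀ _ h]
  rw [ho]
  set s := segCoord x y z
  rcases le_total s 0 with h | h
  · simp [hermiteDeriv, clamp01, h]
  rcases le_total 1 s with h' | h'
  · simp [hermiteDeriv, clamp01, h']
  · simp [clamp01_of_mem h h']

theorem segCoord_sq_le {d : ℕ} (x y z : Fin d → ℝ) :
    segCoord x y z ^ 2 ≤ vnorm2 (z - x) * (vnorm2 (y - x))⁻¹ := by
  unfold segCoord
  by_cases h : vnorm2 (y - x) = 0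
  · simp [h]
  have h' := lt_of_le_of_ne (vnorm2_nonneg _) (Ne.symm h)
  rw [div_pow, ← div_eq_mul_inv, div_le_div_iff₀ (by positivity) h']
  have := dotProduct_sq_le (z - x) (y - x)
  nlinarith

theorem abs_segVal_sub_le {d : ℕ} {a b B : ℝ} (hab : |b - a| ≤ B) (x y z : Fin d → ℝ) :
    |segVal a b x y z - a| ≤ 3 * B * (vnorm2 (z - x) * (vnorm2 (y - x))⁻¹) := by
  have hs := segCoord_sq_le x y z
  unfold segVal
  rw [add_sub_cancel_left, abs_mul, abs_of_nonneg (hermite_nonneg _)]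
  calc |b - a| * hermite (segCoord x y z) ≤ B * (3 * segCoord x y z ^ 2) :=
        mul_le_mul hab (hermite_le_sq _) (hermite_nonneg _) ((abs_nonneg _).trans hab)
    _ ≤ B * (3 * (vnorm2 (z - x) * (vnorm2 (y - x))⁻¹)) := by
        have := (abs_nonneg _).trans hab
        gcongr
    _ = _ := by ring

theorem segSlope2_le {d : ℕ} {r B : ℝ} (hr : |r| ≤ B) (x y z : Fin d → ℝ) :
    segSlope2 r x y z ≤ 36 * B ^ 2 * (vnorm2 (z - x) * (vnorm2 (y - x))⁻¹ ^ 2) := by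
  have hs := segCoord_sq_le x y z
  have hv : 0 ≤ (vnorm2 (y - x))⁻¹ := inv_nonneg.2 (vnorm2_nonneg _)
  have hr2 : r ^ 2 ≤ B ^ 2 := sq_le_sq' (abs_le.1 hr).1 (abs_le.1 hr).2
  unfold segSlope2
  rw [div_eq_mul_inv, mul_pow]
  calc r ^ 2 * hermiteDeriv (segCoord x y z) ^ 2 * (vnorm2 (y - x))⁻¹
      ≤ B ^ 2 * (36 * (vnorm2 (z - x) * (vnorm2 (y - x))⁻¹)) * (vnorm2 (y - x))⁻¹ := by
        gcongr
        exact (hermiteDeriv_sq_le _).trans (by gcongr)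
    _ = _ := by ring

theorem segSlope2_le_const {d : ℕ} {r B : ℝ} (hr : |r| ≤ B) (x y z : Fin d → ℝ) :
    segSlope2 r x y z ≤ 36 * B ^ 2 * (vnorm2 (y - x))⁻¹ := by
  have hv : 0 ≤ (vnorm2 (y - x))⁻¹ := inv_nonneg.2 (vnorm2_nonneg _)
  have hr2 : r ^ 2 ≤ B ^ 2 := sq_le_sq' (abs_le.1 hr).1 (abs_le.1 hr).2
  unfold segSlope2
  rw [div_eq_mul_inv, mul_pow]
  calc r ^ 2 * hermiteDeriv (segCoord x y z) ^ 2 * (vnorm2 (y - x))⁻¹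
      ≤ B ^ 2 * 36 * (vnorm2 (y - x))⁻¹ := by
        gcongr
        exact hermiteDeriv_sq_le_const _
    _ = _ := by ring

theorem segVal_nonneg {d : ℕ} {a b : ℝ} (ha : 0 ≤ a) (hb : 0 ≤ b) (x y z : Fin d → ℝ) :
    0 ≤ segVal a b x y z := by
  have h0 := hermite_nonneg (segCoord x y z)
  have h1 := hermite_le_one (segCoord x y z)
  unfold segVal
  nlinarith [mul_nonneg ha (sub_nonneg.2 h1), mul_nonneg hb h0]

theorem segVal_le {d : ℕ} {a b B : ℝ} (ha : a ≤ B) (hb : b ≤ B) (x y z : Fin d → ℝ) :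
    segVal a b x y z ≤ B := by
  have h0 := hermite_nonneg (segCoord x y z)
  have h1 := hermite_le_one (segCoord x y z)
  unfold segVal
  nlinarith [mul_nonneg (sub_nonneg.2 ha) (sub_nonneg.2 h1), mul_nonneg (sub_nonneg.2 hb) h0]

theorem contDiff_segCoord {d : ℕ} (x y : Fin d → ℝ) : ContDiff ℝ 1 (segCoord x y) := by
  unfold segCoord dotProduct
  simp only [Pi.sub_apply]
  fun_prop

theorem locallyLipschitz_clamp01_segCoord {d : ℕ} (x y : Fin d → ℝ) :
    LocallyLipschitz fun z => (clamp01 (segCoord x y z), z) :=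
  (lipschitzWith_clamp01.locallyLipschitz.comp (contDiff_segCoord x y).locallyLipschitz).prodMk
    LocallyLipschitz.id

theorem locallyLipschitz_segDist2 {d : ℕ} (x y : Fin d → ℝ) : LocallyLipschitz (segDist2 x y) := by
  have h : ContDiff ℝ 1 fun w : ℝ × (Fin d → ℝ) => vnorm2 (w.2 - (x + w.1 • (y - x))) := by
    refine contDiff_vnorm2.comp ?_
    fun_prop
  have h' := h.locallyLipschitz.comp (locallyLipschitz_clamp01_segCoord x y)
  have e : segDist2 x y = (fun w : ℝ × (Fin d → ℝ) => vnorm2 (w.2 - (x + w.1 • (y - x)))) ∘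
      fun z => (clamp01 (segCoord x y z), z) := rfl
  rwa [e]

theorem locallyLipschitz_segWell {d : ℕ} (M a b : ℝ) (x y : Fin d → ℝ) :
    LocallyLipschitz (segWell M a b x y) := by
  have h : ContDiff ℝ 1 fun w : ℝ × (Fin d → ℝ) => a + (b - a) * (3 * w.1 ^ 2 - 2 * w.1 ^ 3) +
      M * vnorm2 (w.2 - (x + w.1 • (y - x))) := by
    have := contDiff_vnorm2 (d := d)
    fun_prop
  have h' := h.locallyLipschitz.comp (locallyLipschitz_clamp01_segCoord x y)
  have e : segWell M a b x y = (fun w : ℝ × (Fin d → ℝ) =>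
      a + (b - a) * (3 * w.1 ^ 2 - 2 * w.1 ^ 3) +
      M * vnorm2 (w.2 - (x + w.1 • (y - x)))) ∘
      fun z => (clamp01 (segCoord x y z), z) := rfl
  rwa [e]

theorem locallyLipschitz_segSlope2 {d : ℕ} (r : ℝ) (x y : Fin d → ℝ) :
    LocallyLipschitz (segSlope2 r x y) := by
  have h : ContDiff ℝ 1 fun w : ℝ × (Fin d → ℝ) =>
      (r * (6 * (w.1 * (1 - w.1)))) ^ 2 / vnorm2 (y - x) := by
    fun_prop
  have h' := h.locallyLipschitz.comp (locallyLipschitz_clamp01_segCoord x y)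
  have e : segSlope2 r x y = (fun w : ℝ × (Fin d → ℝ) =>
      (r * (6 * (w.1 * (1 - w.1)))) ^ 2 / vnorm2 (y - x)) ∘
      fun z => (clamp01 (segCoord x y z), z) := rfl
  rwa [e]

/-- A function touched from above by `segWell` has derivative along a curve controlled by the slope
of `segWell`. -/
theorem abs_deriv_le_of_le_segWell {d : ℕ} {M a b r : ℝ} {x y : Fin d → ℝ} (hM : 0 ≤ M)
    (hr : |b - a| ≤ r) {φ : (Fin d → ℝ) → ℝ} (hφ : ∀ z, φ z ≤ segWell M a b x y z)
    {γ : ℝ → Fin d → ℝ} {t : ℝ} {γ' : Fin d → ℝ} {D : ℝ}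
    (heq : φ (γ t) = segWell M a b x y (γ t))
    (hγ : HasDerivAt γ γ' t) (hD : HasDerivAt (fun s => φ (γ s)) D t) :
    |D| ≤ Real.sqrt (segSlope2 r x y (γ t) + 4 * M ^ 2 * segDist2 x y (γ t)) *
      Real.sqrt (vnorm2 γ') := by
  set f := segFoot x y (γ t) with hf
  set h' := hermiteDeriv (segCoord x y (γ t)) with hh'
  set g : Fin d → ℝ := ((b - a) * h' * (vnorm2 (y - x))⁻¹) • (y - x) + (2 * M) • (γ t - f) with hg
  have hcoord : HasDerivAt (fun s => segCoord x y (γ s))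
      ((γ' ⬝ᵥ (y - x)) * (vnorm2 (y - x))⁻¹) t := by
    unfold segCoord dotProduct
    simp only [div_eq_mul_inv]
    refine HasDerivAt.mul_const ?_ _
    refine HasDerivAt.fun_sum fun i _ => ?_
    exact (((hasDerivAt_pi.1 hγ) i).sub_const (x i)).mul_const _
  have hdist : HasDerivAt (fun s => vnorm2 (γ s - f)) (2 * ((γ t - f) ⬝ᵥ γ')) t := by
    unfold vnorm2 dotProduct
    rw [Finset.mul_sum]
    refine HasDerivAt.fun_sum fun i _ => ?_
    have := (((hasDerivAt_pi.1 hγ) i).sub_const (f i)).fun_pow 2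
    refine this.congr_deriv ?_
    simp
    ring
  have hB : HasDerivAt (fun s => (a + (b - a) * hermite (segCoord x y (γ s)) +
      M * vnorm2 (γ s - f)) - φ (γ s)) ((b - a) * (h' * ((γ' ⬝ᵥ (y - x)) * (vnorm2 (y - x))⁻¹)) +
      M * (2 * ((γ t - f) ⬝ᵥ γ')) - D) t := by
    refine HasDerivAt.fun_sub (HasDerivAt.fun_add (HasDerivAt.const_add a
      (HasDerivAt.const_mul _ ?_))
      (HasDerivAt.const_mul _ hdist)) hD
    exact (hasDerivAt_hermite _).comp t hcoord
  have hmin : IsLocalMin (fun s => (a + (b - a) * hermite (segCoord x y (γ s)) +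
      M * vnorm2 (γ s - f)) - φ (γ s)) t := by
    refine Eventually.of_forall fun s => ?_
    have e0 : a + (b - a) * hermite (segCoord x y (γ t)) + M * vnorm2 (γ t - f) - φ (γ t) = 0 := by
      rw [heq]; simp [segWell, segVal, segDist2, hf]
    have e1 := hφ (γ s)
    have e2 : segDist2 x y (γ s) ≤ vnorm2 (γ s - f) :=
      segDist2_le x y (γ s) (clamp01_nonneg _) (clamp01_le_one _)
    have e3 := mul_le_mul_of_nonneg_left e2 hM
    simp only [segWell, segVal] at e1
    show _ ≤ _
    beta_reduce
    linarith
  have hDeq : D = g ⬝ᵥ γ' := by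
    have := hmin.hasDerivAt_eq_zero hB
    rw [hg, add_dotProduct, smul_dotProduct, smul_dotProduct, dotProduct_comm (y - x)]
    simp only [smul_eq_mul]
    linarith
  have horth : h' * ((γ t - f) ⬝ᵥ (y - x)) = 0 := hermiteDeriv_mul_sub_segFoot x y (γ t)
  have hgn : vnorm2 g ≤ segSlope2 r x y (γ t) + 4 * M ^ 2 * segDist2 x y (γ t) := by
    rw [hg, vnorm2_add, vnorm2_smul, vnorm2_smul, smul_dotProduct, dotProduct_smul,
      dotProduct_comm (y - x)]
    have e1 : ((b - a) * h' * (vnorm2 (y - x))⁻¹) ^ 2 * vnorm2 (y - x) ≤ segSlope2 r x y (γ t) := by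
      unfold segSlope2
      rw [← hh']
      by_cases h : vnorm2 (y - x) = 0
      · simp [h]
      have hpos := lt_of_le_of_ne (vnorm2_nonneg _) (Ne.symm h)
      have : ((b - a) * h' * (vnorm2 (y - x))⁻¹) ^ 2 * vnorm2 (y - x) =
          ((b - a) * h') ^ 2 / vnorm2 (y - x) := by field_simp
      rw [this, mul_pow, mul_pow]
      have : (b - a) ^ 2 ≤ r ^ 2 := sq_le_sq' (abs_le.1 hr).1 (abs_le.1 hr).2
      gcongr
    have e2 : 2 * (((b - a) * h' * (vnorm2 (y - x))⁻¹) • (2 * M) • ((γ t - f) ⬝ᵥ (y - x))) = 0 := by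
      simp only [smul_eq_mul]
      linear_combination (4 * M * (b - a) * (vnorm2 (y - x))⁻¹) * horth
    rw [e2]
    have e3 : vnorm2 (γ t - f) = segDist2 x y (γ t) := rfl
    rw [e3]
    nlinarith
  rw [hDeq, ← Real.sqrt_mul ((vnorm2_nonneg g).trans hgn)]
  refine Real.abs_le_sqrt ((dotProduct_sq_le _ _).trans ?_)
  exact mul_le_mul_of_nonneg_right hgn (vnorm2_nonneg _)

/-! ### Separation of the segments joining affinely independent points -/

theorem exists_barycentric {d : ℕ} {p : Fin (d + 1) → Fin d → ℝ} (hp : AffineIndependent ℝ p) :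
    ∃ c : Fin (d + 1) → (Fin d → ℝ) →ᵃ[ℝ] ℝ,
      (∀ l m, c l (p m) = if l = m then 1 else 0) ∧ ∀ z, ∑ l, c l z = 1 := by
  let b : AffineBasis (Fin (d + 1)) ℝ (Fin d → ℝ) :=
    ⟨p, hp, (hp.affineSpan_eq_top_iff_card_eq_finrank_add_one).2 (by simp)⟩
  refine ⟨b.coord, fun l m => ?_, fun z => b.sum_coord_apply_eq_one z⟩
  exact b.coord_apply l m

theorem exists_sq_sub_le_vnorm2 {d : ℕ} (c : (Fin d → ℝ) →ᵃ[ℝ] ℝ) :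
    ∃ C, 0 ≤ C ∧ ∀ x y, (c x - c y) ^ 2 ≤ C * vnorm2 (x - y) := by
  refine ⟨‖c.linear.toContinuousLinearMap‖ ^ 2, sq_nonneg _, fun x y => ?_⟩
  have h1 : c x - c y = c.linear.toContinuousLinearMap (x - y) := by
    have := c.linearMap_vsub x y
    simpa using this.symm
  have h2 := c.linear.toContinuousLinearMap.le_opNorm (x - y)
  rw [← h1, Real.norm_eq_abs] at h2
  calc (c x - c y) ^ 2 = |c x - c y| ^ 2 := (sq_abs _).symm
    _ ≤ (‖c.linear.toContinuousLinearMap‖ * ‖x - y‖) ^ 2 := by gcongr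
    _ = ‖c.linear.toContinuousLinearMap‖ ^ 2 * ‖x - y‖ ^ 2 := mul_pow _ _ _
    _ ≤ _ := by gcongr; exact norm_sq_le_vnorm2 _

theorem exists_forall_le {ι : Type*} [Finite ι] (f : ι → ℝ) : ∃ C, 0 ≤ C ∧ ∀ i, f i ≤ C := by
  obtain ⟨C, hC⟩ := (Set.finite_range f).bddAbove
  exact ⟨max 0 C, le_max_left _ _, fun i => (hC ⟨i, rfl⟩).trans (le_max_right _ _)⟩

theorem apply_lineMap_point {d : ℕ} (c : (Fin d → ℝ) →ᵃ[ℝ] ℝ) (x y : Fin d → ℝ) (t : ℝ) :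
    c (x + t • (y - x)) = c x + t * (c y - c x) := by
  have := c.apply_lineMap x y t
  rw [AffineMap.lineMap_apply_module', AffineMap.lineMap_apply_module'] at this
  rw [add_comm x, this, add_comm, smul_eq_mul]

theorem exists_coord_sq_le {d : ℕ} {p : Fin (d + 1) → Fin d → ℝ} (hp : AffineIndependent ℝ p) :
    ∃ c : Fin (d + 1) → (Fin d → ℝ) →ᵃ[ℝ] ℝ,
      (∀ l m, c l (p m) = if l = m then 1 else 0) ∧
      ∃ C, 0 ≤ C ∧ ∀ l m n z, l ≠ m → l ≠ n → c l z ^ 2 ≤ C * segDist2 (p m) (p n) z := by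
  obtain ⟨c, hc, -⟩ := exists_barycentric hp
  choose A hA0 hA using fun l => exists_sq_sub_le_vnorm2 (c l)
  obtain ⟨C, hC0, hC⟩ := exists_forall_le A
  refine ⟨c, hc, C, hC0, fun l m n z hm hn => ?_⟩
  have h := hA l z (segFoot (p m) (p n) z)
  have h0 : c l (segFoot (p m) (p n) z) = 0 := by
    unfold segFoot
    rw [apply_lineMap_point, hc, hc, if_neg hm, if_neg hn]
    ring
  rw [h0, sub_zero] at h
  exact h.trans (mul_le_mul_of_nonneg_right (hC l) (vnorm2_nonneg _))

/-- Interpolations along two segments differ at a point of one of the segments by at most a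
multiple of the squared distance to the other one. -/
theorem exists_segVal_compare {d : ℕ} {p : Fin (d + 1) → Fin d → ℝ} (hp : AffineIndependent ℝ p)
    {δ : Fin (d + 1) → Fin (d + 1) → ℝ} {B : ℝ} (h0 : ∀ i j, 0 ≤ δ i j) (hB : ∀ i j, δ i j ≤ B)
    (hsymm : ∀ i j, δ i j = δ j i) :
    ∃ C, 0 ≤ C ∧ ∀ j k, j ≠ k → ∀ τ ∈ Set.Icc (0 : ℝ) 1, ∀ m n,
      ((m = j ∧ n = k) ∨ (m = k ∧ n = j)) ∨
      ((∀ i, |segVal (δ i m) (δ i n) (p m) (p n) (p j + τ • (p k - p j)) -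
          segVal (δ i j) (δ i k) (p j) (p k) (p j + τ • (p k - p j))| ≤
        C * segDist2 (p m) (p n) (p j + τ • (p k - p j))) ∧
      segSlope2 (δ m n) (p m) (p n) (p j + τ • (p k - p j)) ≤
        C * segDist2 (p m) (p n) (p j + τ • (p k - p j))) := by
  obtain ⟨c, hc, A, hA0, hA⟩ := exists_coord_sq_le hp
  obtain ⟨L, hL0, hL⟩ := exists_forall_le fun e : Fin (d + 1) × Fin (d + 1) =>
    (vnorm2 (p e.2 - p e.1))⁻¹
  obtain ⟨S, hS0, hS⟩ := exists_forall_le fun e : Fin (d + 1) × Fin (d + 1) =>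
    vnorm2 (p e.2 - p e.1)
  have hB0 : 0 ≤ B := (h0 0 0).trans (hB 0 0)
  have habs : ∀ i j k, |δ i j - δ i k| ≤ B := fun i j k => by
    rw [abs_le]; constructor <;> linarith [h0 i j, h0 i k, hB i j, hB i k]
  have habs1 : ∀ i j, |δ i j| ≤ B := fun i j => by rw [abs_of_nonneg (h0 i j)]; exact hB i j
  -- one common vertex
  have shared : ∀ o k n, o ≠ k → n ≠ k → ∀ τ : ℝ,
      (∀ i, |segVal (δ i o) (δ i n) (p o) (p n) (p o + τ • (p k - p o)) -
          segVal (δ i o) (δ i k) (p o) (p k) (p o + τ • (p k - p o))| ≤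
        (6 * B * (S * A) * L) * segDist2 (p o) (p n) (p o + τ • (p k - p o))) ∧
      segSlope2 (δ o n) (p o) (p n) (p o + τ • (p k - p o)) ≤
        (36 * B ^ 2 * (S * A) * L ^ 2) * segDist2 (p o) (p n) (p o + τ • (p k - p o)) := by
    intro o k n hok hnk τ
    set z := p o + τ • (p k - p o) with hz
    set q := segDist2 (p o) (p n) z with hq
    have hq0 : 0 ≤ q := segDist2_nonneg _ _ _
    have hτ : τ ^ 2 ≤ A * q := by
      have := hA k o n z hok.symm hnk.symm
      rwa [hz, apply_lineMap_point, hc, hc, if_neg hok.symm, if_pos rfl, zero_add, sub_zero,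
        mul_one] at this
    have hv : vnorm2 (z - p o) ≤ S * A * q := by
      rw [hz, add_sub_cancel_left, vnorm2_smul]
      calc τ ^ 2 * vnorm2 (p k - p o) ≤ (A * q) * S := by
            gcongr
            · exact vnorm2_nonneg _
            · exact hS (o, k)
        _ = _ := by ring
    have hbound : ∀ l, vnorm2 (z - p o) * (vnorm2 (p l - p o))⁻¹ ≤ S * A * q * L := fun l => by
      gcongr
      · exact inv_nonneg.2 (vnorm2_nonneg _)
      · exact hL (o, l)
    constructor
    · intro i
      have e1 := abs_segVal_sub_le (habs i n o) (p o) (p n) z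
      have e2 := abs_segVal_sub_le (habs i k o) (p o) (p k) z
      have e3 := mul_le_mul_of_nonneg_left (hbound n) (by positivity : 0 ≤ 3 * B)
      have e4 := mul_le_mul_of_nonneg_left (hbound k) (by positivity : 0 ≤ 3 * B)
      rw [abs_le] at *
      constructor <;> linarith
    · refine (segSlope2_le (habs1 o n) (p o) (p n) z).trans ?_
      calc 36 * B ^ 2 * (vnorm2 (z - p o) * (vnorm2 (p n - p o))⁻¹ ^ 2)
          ≤ 36 * B ^ 2 * ((S * A * q) * L ^ 2) := by
            gcongr
            · exact inv_nonneg.2 (vnorm2_nonneg _)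
            · exact hL (o, n)
        _ = _ := by ring
  have hinj := hp.injective
  set C := 6 * B * (S * A) * L + 36 * B ^ 2 * (S * A) * L ^ 2 + 4 * A * (B + 36 * B ^ 2 * L) with hC
  have c1 : 6 * B * (S * A) * L ≤ C := by
    have : 0 ≤ 36 * B ^ 2 * (S * A) * L ^ 2 + 4 * A * (B + 36 * B ^ 2 * L) := by positivity
    linarith
  have c2 : 36 * B ^ 2 * (S * A) * L ^ 2 ≤ C := by
    have : 0 ≤ 6 * B * (S * A) * L + 4 * A * (B + 36 * B ^ 2 * L) := by positivity
    linarith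
  have shared' : ∀ o k n, o ≠ k → n ≠ k → ∀ τ : ℝ,
      (∀ i, |segVal (δ i o) (δ i n) (p o) (p n) (p o + τ • (p k - p o)) -
          segVal (δ i o) (δ i k) (p o) (p k) (p o + τ • (p k - p o))| ≤
        C * segDist2 (p o) (p n) (p o + τ • (p k - p o))) ∧
      segSlope2 (δ o n) (p o) (p n) (p o + τ • (p k - p o)) ≤
        C * segDist2 (p o) (p n) (p o + τ • (p k - p o)) := by
    intro o k n hok hnk τ
    obtain ⟨e1, e2⟩ := shared o k n hok hnk τ
    exact ⟨fun i => (e1 i).trans (mul_le_mul_of_nonneg_right c1 (segDist2_nonneg _ _ _)),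
      e2.trans (mul_le_mul_of_nonneg_right c2 (segDist2_nonneg _ _ _))⟩
  have C0 : 0 ≤ C := by positivity
  refine ⟨C, C0, fun j k hjk τ hτ m n => ?_⟩
  set z := p j + τ • (p k - p j) with hz
  have hz' : z = p k + (1 - τ) • (p j - p k) := by rw [hz]; module
  by_cases hmj : m = j
  · by_cases hnk : n = k
    · exact .inl (.inl ⟨hmj, hnk⟩)
    · rw [hmj]
      exact .inr (shared' j k n hjk hnk τ)
  by_cases hnj : n = j
  · by_cases hmk : m = k
    · exact .inl (.inr ⟨hmk, hnj⟩)
    · rw [hnj]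
      have hpm : p j ≠ p m := fun h => hmj (hinj h).symm
      have h := shared' j k m hjk hmk τ
      rw [← hz, segDist2_swap, ← segSlope2_swap, hsymm j m] at h
      refine .inr ⟨fun i => ?_, h.2⟩
      rw [segVal_swap _ _ hpm]
      exact h.1 i
  have hpkj : p k ≠ p j := fun h => hjk (hinj h).symm
  by_cases hmk : m = k
  · rw [hmk]
    have h := shared' k j n hjk.symm hnj (1 - τ)
    rw [← hz'] at h
    refine .inr ⟨fun i => ?_, h.2⟩
    rw [segVal_swap _ _ hpkj]
    exact h.1 i
  by_cases hnk : n = k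
  · rw [hnk]
    have hpm : p k ≠ p m := fun h => hmk (hinj h).symm
    have h := shared' k j m hjk.symm hmj (1 - τ)
    rw [← hz', segDist2_swap, ← segSlope2_swap, hsymm k m] at h
    refine .inr ⟨fun i => ?_, h.2⟩
    rw [segVal_swap _ _ hpkj, segVal_swap _ _ hpm]
    exact h.1 i
  -- disjoint segments
  right
  set q := segDist2 (p m) (p n) z with hq
  have hq0 : 0 ≤ q := segDist2_nonneg _ _ _
  have e1 := hA j m n z (Ne.symm hmj) (Ne.symm hnj)
  have e2 := hA k m n z (Ne.symm hmk) (Ne.symm hnk)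
  rw [← hq, hz, apply_lineMap_point, hc, hc, if_pos rfl, if_neg hjk] at e1
  rw [← hq, hz, apply_lineMap_point, hc, hc, if_neg hjk.symm, if_pos rfl] at e2
  have e3 : 1 ≤ 4 * A * q := by nlinarith [sq_nonneg (1 - 2 * τ)]
  have e4 : B + 36 * B ^ 2 * L ≤ C * q := by
    have h1 : 0 ≤ B + 36 * B ^ 2 * L := by positivity
    have h2 := mul_le_mul_of_nonneg_right e3 h1
    have h3 : 4 * A * (B + 36 * B ^ 2 * L) ≤ C := by
      have : 0 ≤ 6 * B * (S * A) * L + 36 * B ^ 2 * (S * A) * L ^ 2 := by positivity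
      linarith
    have h4 := mul_le_mul_of_nonneg_right h3 hq0
    linarith
  constructor
  · intro i
    refine le_trans ?_ ((le_add_of_nonneg_right (by positivity)).trans e4)
    have f1 := segVal_nonneg (h0 i m) (h0 i n) (p m) (p n) z
    have f2 := segVal_nonneg (h0 i j) (h0 i k) (p j) (p k) z
    have f3 := segVal_le (hB i m) (hB i n) (p m) (p n) z
    have f4 := segVal_le (hB i j) (hB i k) (p j) (p k) z
    rw [abs_le]
    constructor <;> linarith
  · refine le_trans ((segSlope2_le_const (habs1 m n) (p m) (p n) z).trans ?_)
      ((le_add_of_nonneg_left hB0).trans e4)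
    gcongr
    exact hL (m, n)

/-! ### The potential -/

/-- The derivative of `φ` along curves is controlled by the degenerate metric `2 W g₀`. -/
def Calibrates {d : ℕ} (W φ : (Fin d → ℝ) → ℝ) : Prop :=
  ∀ (γ : ℝ → Fin d → ℝ) (t : ℝ) (γ' : Fin d → ℝ) (D : ℝ), HasDerivAt γ γ' t →
    HasDerivAt (fun s => φ (γ s)) D t → |D| ≤ Real.sqrt (2 * W (γ t)) * Real.sqrt (vnorm2 γ')

/-- The well of the `i`-th calibration around the segment joining the pair `e` of vertices. -/
def edgeWell {d : ℕ} (M : ℝ) (p : Fin (d + 1) → Fin d → ℝ) (δ : Fin (d + 1) → Fin (d + 1) → ℝ)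
    (i : Fin (d + 1)) (e : Fin (d + 1) × Fin (d + 1)) (z : Fin d → ℝ) : ℝ :=
  segWell M (δ i e.1) (δ i e.2) (p e.1) (p e.2) z

/-- The squared gradient bound of `edgeWell`. -/
def edgeSlope2 {d : ℕ} (M : ℝ) (p : Fin (d + 1) → Fin d → ℝ) (δ : Fin (d + 1) → Fin (d + 1) → ℝ)
    (e : Fin (d + 1) × Fin (d + 1)) (z : Fin d → ℝ) : ℝ :=
  segSlope2 (δ e.1 e.2) (p e.1) (p e.2) z + 4 * M ^ 2 * segDist2 (p e.1) (p e.2) z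

/-- The squared distance to the complete graph spanned by the vertices. -/
def graphDist2 {d : ℕ} (p : Fin (d + 1) → Fin d → ℝ) (z : Fin d → ℝ) : ℝ :=
  Finset.univ.inf' Finset.univ_nonempty
    fun e : Fin (d + 1) × Fin (d + 1) => segDist2 (p e.1) (p e.2) z

/-- The `i`-th calibration. -/
def graphCalib {d : ℕ} (M c : ℝ) (p : Fin (d + 1) → Fin d → ℝ)
    (δ : Fin (d + 1) → Fin (d + 1) → ℝ) (i : Fin (d + 1)) (z : Fin d → ℝ) : ℝ :=
  min c (Finset.univ.inf' Finset.univ_nonempty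
    fun e : Fin (d + 1) × Fin (d + 1) => edgeWell M p δ i e z)

/-- The largest squared slope of the wells, penalized where the well is not active. -/
def graphSlope2 {d : ℕ} (M K c : ℝ) (p : Fin (d + 1) → Fin d → ℝ)
    (δ : Fin (d + 1) → Fin (d + 1) → ℝ) (z : Fin d → ℝ) : ℝ :=
  Finset.univ.sup' Finset.univ_nonempty
    fun a : Fin (d + 1) × (Fin (d + 1) × Fin (d + 1)) =>
      edgeSlope2 M p δ a.2 z - K * (edgeWell M p δ a.1 a.2 z - graphCalib M c p δ a.1 z)

/-- The potential. -/
def graphPot {d : ℕ} (M K c : ℝ) (p : Fin (d + 1) → Fin d → ℝ)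
    (δ : Fin (d + 1) → Fin (d + 1) → ℝ) (z : Fin d → ℝ) : ℝ :=
  1 / 2 * max 0 (graphSlope2 M K c p δ z) + min 1 (graphDist2 p z)

section regularity

theorem locallyLipschitz_inf' {α ι : Type*} [PseudoEMetricSpace α] {s : Finset ι}
    (hs : s.Nonempty) {f : ι → α → ℝ} (hf : ∀ i ∈ s, LocallyLipschitz (f i)) :
    LocallyLipschitz fun z => s.inf' hs fun i => f i z := by
  have := Finset.inf'_induction hs f (p := LocallyLipschitz) (fun _ h₁ _ h₂ => h₁.min h₂) hf
  convert this using 1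
  ext z
  rw [Finset.inf'_apply]

theorem locallyLipschitz_sup' {α ι : Type*} [PseudoEMetricSpace α] {s : Finset ι}
    (hs : s.Nonempty) {f : ι → α → ℝ} (hf : ∀ i ∈ s, LocallyLipschitz (f i)) :
    LocallyLipschitz fun z => s.sup' hs fun i => f i z := by
  have := Finset.sup'_induction hs f (p := LocallyLipschitz) (fun _ h₁ _ h₂ => h₁.max h₂) hf
  convert this using 1
  ext z
  rw [Finset.sup'_apply]

theorem LocallyLipschitz.const_mul_real {α : Type*} [PseudoEMetricSpace α] {f : α → ℝ}
    (hf : LocallyLipschitz f) (c : ℝ) : LocallyLipschitz fun x => c * f x :=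
  (lipschitzWith_smul c).locallyLipschitz.comp hf

theorem locallyLipschitz_graphCalib {d : ℕ} (M c : ℝ) (p : Fin (d + 1) → Fin d → ℝ)
    (δ : Fin (d + 1) → Fin (d + 1) → ℝ) (i : Fin (d + 1)) :
    LocallyLipschitz (graphCalib M c p δ i) :=
  (locallyLipschitz_inf' _ fun _ _ => locallyLipschitz_segWell _ _ _ _ _).const_min c

theorem locallyLipschitz_graphPot {d : ℕ} (M K c : ℝ) (p : Fin (d + 1) → Fin d → ℝ)
    (δ : Fin (d + 1) → Fin (d + 1) → ℝ) : LocallyLipschitz (graphPot M K c p δ) := by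
  have h1 : LocallyLipschitz (graphSlope2 M K c p δ) :=
    locallyLipschitz_sup' _ fun a _ =>
      ((locallyLipschitz_segSlope2 _ _ _).add
        ((locallyLipschitz_segDist2 _ _).const_mul_real _)).sub
        (((locallyLipschitz_segWell _ _ _ _ _).sub
          (locallyLipschitz_graphCalib M c p δ a.1)).const_mul_real K)
  have h2 : LocallyLipschitz (graphDist2 p) :=
    locallyLipschitz_inf' _ fun _ _ => locallyLipschitz_segDist2 _ _
  exact ((h1.const_max 0).const_mul_real _).add (h2.const_min 1)

theorem exists_lipschitzWith_of_eq_const {d : ℕ} {W : (Fin d → ℝ) → ℝ} (hW : LocallyLipschitz W)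
    {ρ c : ℝ} (hρ : 0 ≤ ρ) (h : ∀ z, ρ ≤ ‖z‖ → W z = c) : ∃ K : NNReal, LipschitzWith K W := by
  obtain ⟨K, hK⟩ := LocallyLipschitzOn.exists_lipschitzOnWith_of_compact
    (isCompact_closedBall (0 : Fin d → ℝ) ρ) hW.locallyLipschitzOn
  let P : (Fin d → ℝ) → Fin d → ℝ := fun z i => max (-ρ) (min ρ (z i))
  have hP : LipschitzWith 1 P := by
    refine LipschitzWith.of_dist_le_mul fun x y => ?_
    rw [NNReal.coe_one, one_mul, dist_pi_le_iff dist_nonneg]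
    intro i
    have : LipschitzWith 1 fun s : ℝ => max (-ρ) (min ρ s) :=
      (LipschitzWith.id.const_min ρ).const_max (-ρ)
    have h1 := this.dist_le_mul (x i) (y i)
    rw [NNReal.coe_one, one_mul] at h1
    exact h1.trans (dist_le_pi_dist x y i)
  have hPmem : ∀ z, P z ∈ Metric.closedBall (0 : Fin d → ℝ) ρ := fun z => by
    rw [mem_closedBall_zero_iff, pi_norm_le_iff_of_nonneg hρ]
    intro i
    rw [Real.norm_eq_abs, abs_le]
    exact ⟨le_max_left _ _, max_le (by linarith) (min_le_left _ _)⟩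
  have hWP : ∀ z, W z = W (P z) := fun z => by
    by_cases hz : ∀ i, |z i| ≤ ρ
    · congr 1
      ext i
      obtain ⟨h1, h2⟩ := abs_le.1 (hz i)
      simp [P, h1, h2]
    · push Not at hz
      obtain ⟨i, hi⟩ := hz
      have h1 : |z i| ≤ ‖z‖ := norm_le_pi_norm z i
      have h2 : |P z i| ≤ ‖P z‖ := norm_le_pi_norm (P z) i
      have h3 : ρ ≤ |P z i| := by
        rcases lt_abs.1 hi with h4 | h4
        · exact le_trans (le_trans (by simp [h4.le]) (le_max_right (-ρ) (min ρ (z i))))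
            (le_abs_self _)
        · have : P z i = -ρ := by
            have : min ρ (z i) ≤ -ρ := (min_le_right _ _).trans (by linarith)
            simp only [P]; exact max_eq_left this
          rw [this, abs_neg]; exact le_abs_self _
      rw [h z (hi.le.trans h1), h (P z) (h3.trans h2)]
  refine ⟨K * 1, ?_⟩
  have h1 : LipschitzOnWith (K * 1) (W ∘ P) Set.univ :=
    hK.comp hP.lipschitzOnWith fun z _ => hPmem z
  rw [lipschitzOnWith_univ] at h1
  rwa [show W = W ∘ P from funext hWP]

end regularity

theorem graphDist2_nonneg {d : ℕ} (p : Fin (d + 1) → Fin d → ℝ) (z : Fin d → ℝ) :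
    0 ≤ graphDist2 p z :=
  Finset.le_inf' _ _ fun _ _ => segDist2_nonneg _ _ _

theorem graphPot_nonneg {d : ℕ} (M K c : ℝ) (p : Fin (d + 1) → Fin d → ℝ)
    (δ : Fin (d + 1) → Fin (d + 1) → ℝ) (z : Fin d → ℝ) : 0 ≤ graphPot M K c p δ z := by
  have h1 := le_max_left 0 (graphSlope2 M K c p δ z)
  have h2 := le_min zero_le_one (graphDist2_nonneg p z)
  unfold graphPot
  linarith

theorem graphCalib_le_edgeWell {d : ℕ} (M c : ℝ) (p : Fin (d + 1) → Fin d → ℝ)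
    (δ : Fin (d + 1) → Fin (d + 1) → ℝ) (i : Fin (d + 1)) (e : Fin (d + 1) × Fin (d + 1))
    (z : Fin d → ℝ) : graphCalib M c p δ i z ≤ edgeWell M p δ i e z :=
  (min_le_right _ _).trans (Finset.inf'_le (fun e => edgeWell M p δ i e z) (Finset.mem_univ e))

theorem edgeSlope2_le_graphPot {d : ℕ} (M K c : ℝ) (p : Fin (d + 1) → Fin d → ℝ)
    (δ : Fin (d + 1) → Fin (d + 1) → ℝ) {i : Fin (d + 1)} {e : Fin (d + 1) × Fin (d + 1)}
    {z : Fin d → ℝ} (h : graphCalib M c p δ i z = edgeWell M p δ i e z) :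
    edgeSlope2 M p δ e z ≤ 2 * graphPot M K c p δ z := by
  have h1 := Finset.le_sup' (fun a : Fin (d + 1) × (Fin (d + 1) × Fin (d + 1)) =>
    edgeSlope2 M p δ a.2 z - K * (edgeWell M p δ a.1 a.2 z - graphCalib M c p δ a.1 z))
    (Finset.mem_univ (i, e))
  simp only [h, sub_self, mul_zero, sub_zero] at h1
  have h2 := le_max_right 0 (graphSlope2 M K c p δ z)
  have h3 := le_min zero_le_one (graphDist2_nonneg p z)
  unfold graphPot
  change _ ≤ graphSlope2 M K c p δ z at h1
  linarith

theorem calibrates_graphCalib {d : ℕ} {M : ℝ} (K c : ℝ) (hM : 0 ≤ M)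
    (p : Fin (d + 1) → Fin d → ℝ) {δ : Fin (d + 1) → Fin (d + 1) → ℝ}
    (hδ : ∀ i m n, |δ i n - δ i m| ≤ δ m n) (i : Fin (d + 1)) :
    Calibrates (graphPot M K c p δ) (graphCalib M c p δ i) := by
  intro γ t γ' D hγ hD
  obtain ⟨e, -, he⟩ := Finset.exists_mem_eq_inf' Finset.univ_nonempty
    fun e : Fin (d + 1) × Fin (d + 1) => edgeWell M p δ i e (γ t)
  rcases min_choice c (Finset.univ.inf' Finset.univ_nonempty
    fun e : Fin (d + 1) × Fin (d + 1) => edgeWell M p δ i e (γ t)) with h | h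
  · have hmax : IsLocalMax (fun s => graphCalib M c p δ i (γ s)) t := by
      refine Eventually.of_forall fun s => ?_
      have : graphCalib M c p δ i (γ t) = c := h
      beta_reduce
      rw [this]
      exact min_le_left _ _
    rw [hmax.hasDerivAt_eq_zero hD, abs_zero]
    positivity
  · have h' : graphCalib M c p δ i (γ t) = edgeWell M p δ i e (γ t) := h.trans he
    refine (abs_deriv_le_of_le_segWell hM (hδ i e.1 e.2)
      (graphCalib_le_edgeWell M c p δ i e) h' hγ hD).trans ?_
    gcongr
    exact edgeSlope2_le_graphPot M K c p δ h'

section graph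

variable {d : ℕ} {p : Fin (d + 1) → Fin d → ℝ} {δ : Fin (d + 1) → Fin (d + 1) → ℝ} {M K c C : ℝ}

theorem eq_segFoot_of_segDist2_eq_zero {x y z : Fin d → ℝ} (h : segDist2 x y z = 0) :
    z = segFoot x y z :=
  sub_eq_zero.1 (vnorm2_eq_zero.1 h)

theorem segVal_lineMap {x y : Fin d → ℝ} (h : x ≠ y) (a b t : ℝ) :
    segVal a b x y (x + t • (y - x)) = a + (b - a) * hermite t := by
  rw [segVal, segCoord_lineMap h]

theorem segSlope2_lineMap {x y : Fin d → ℝ} (h : x ≠ y) (r : ℝ) {t : ℝ}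
    (ht : t ∈ Set.Icc (0 : ℝ) 1) :
    segSlope2 r x y (x + t • (y - x)) = (r * (6 * (t * (1 - t)))) ^ 2 / vnorm2 (y - x) := by
  rw [segSlope2, segCoord_lineMap h, hermiteDeriv, clamp01_of_mem ht.1 ht.2]

/-- The comparison of interpolations along different edges. -/
def EdgeCompare (p : Fin (d + 1) → Fin d → ℝ) (δ : Fin (d + 1) → Fin (d + 1) → ℝ) (C : ℝ) : Prop :=
  ∀ j k, j ≠ k → ∀ τ ∈ Set.Icc (0 : ℝ) 1, ∀ m n,
      ((m = j ∧ n = k) ∨ (m = k ∧ n = j)) ∨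
      ((∀ i, |segVal (δ i m) (δ i n) (p m) (p n) (p j + τ • (p k - p j)) -
          segVal (δ i j) (δ i k) (p j) (p k) (p j + τ • (p k - p j))| ≤
        C * segDist2 (p m) (p n) (p j + τ • (p k - p j))) ∧
      segSlope2 (δ m n) (p m) (p n) (p j + τ • (p k - p j)) ≤
        C * segDist2 (p m) (p n) (p j + τ • (p k - p j)))

theorem edgeWell_of_edge (hp : Function.Injective p) {j k m n : Fin (d + 1)} (hjk : j ≠ k) {τ : ℝ}
    (hτ : τ ∈ Set.Icc (0 : ℝ) 1) (h : (m = j ∧ n = k) ∨ (m = k ∧ n = j)) (i : Fin (d + 1)) :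
    edgeWell M p δ i (m, n) (p j + τ • (p k - p j)) =
      segVal (δ i j) (δ i k) (p j) (p k) (p j + τ • (p k - p j)) ∧
    segDist2 (p m) (p n) (p j + τ • (p k - p j)) = 0 := by
  have hpjk : p j ≠ p k := fun h => hjk (hp h)
  have h0 := segDist2_lineMap hpjk hτ.1 hτ.2
  unfold edgeWell segWell
  rcases h with ⟨rfl, rfl⟩ | ⟨rfl, rfl⟩
  · simp [h0]
  · rw [segDist2_swap, h0, segVal_swap _ _ hpjk]
    simp

theorem graphCalib_edge (hp : Function.Injective p) (hC : EdgeCompare p δ C) (hM : C ≤ M)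
    (hc : ∀ i j, δ i j ≤ c) {j k : Fin (d + 1)} (hjk : j ≠ k) {τ : ℝ}
    (hτ : τ ∈ Set.Icc (0 : ℝ) 1) (i : Fin (d + 1)) :
    graphCalib M c p δ i (p j + τ • (p k - p j)) =
      segVal (δ i j) (δ i k) (p j) (p k) (p j + τ • (p k - p j)) := by
  apply le_antisymm
  · rw [← (edgeWell_of_edge (M := M) (δ := δ) hp hjk hτ (.inl ⟨rfl, rfl⟩) i).1]
    exact graphCalib_le_edgeWell _ _ _ _ _ _ _
  · refine le_min (segVal_le (hc _ _) (hc _ _) _ _ _) (Finset.le_inf' _ _ fun e _ => ?_)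
    obtain ⟨m, n⟩ := e
    rcases hC j k hjk τ hτ m n with h | ⟨h, -⟩
    · exact (edgeWell_of_edge (M := M) (δ := δ) hp hjk hτ h i).1.ge
    · have h1 := neg_le_of_abs_le (h i)
      have h2 := mul_le_mul_of_nonneg_right hM
        (segDist2_nonneg (p m) (p n) (p j + τ • (p k - p j)))
      simp only [edgeWell, segWell]
      linarith

theorem graphPot_edge (hp : Function.Injective p) (hC : EdgeCompare p δ C) (hM : C + 1 ≤ M)
    (hK0 : 0 ≤ K) (hK : C + 4 * M ^ 2 ≤ K) (hsymm : ∀ i j, δ i j = δ j i)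
    (hc : ∀ i j, δ i j ≤ c) {j k : Fin (d + 1)} (hjk : j ≠ k) {τ : ℝ}
    (hτ : τ ∈ Set.Icc (0 : ℝ) 1) :
    graphPot M K c p δ (p j + τ • (p k - p j)) =
      1 / 2 * ((δ j k * (6 * (τ * (1 - τ)))) ^ 2 / vnorm2 (p k - p j)) := by
  have hpjk : p j ≠ p k := fun h => hjk (hp h)
  set z := p j + τ • (p k - p j) with hz
  have hd := segDist2_lineMap hpjk hτ.1 hτ.2
  rw [← hz] at hd
  have h1 : graphDist2 p z = 0 := by
    refine le_antisymm ?_ (graphDist2_nonneg _ _)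
    rw [← hd]
    exact Finset.inf'_le (fun e : Fin (d + 1) × Fin (d + 1) => segDist2 (p e.1) (p e.2) z)
      (Finset.mem_univ (j, k))
  have hw : ∀ i, graphCalib M c p δ i z = segVal (δ i j) (δ i k) (p j) (p k) z :=
    graphCalib_edge hp hC (by linarith) hc hjk hτ
  have hs := segSlope2_lineMap hpjk (δ j k) hτ
  rw [← hz] at hs
  have hs0 := segSlope2_nonneg (δ j k) (p j) (p k) z
  have h2 : graphSlope2 M K c p δ z = segSlope2 (δ j k) (p j) (p k) z := by
    apply le_antisymm
    · refine Finset.sup'_le _ _ fun a _ => ?_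
      obtain ⟨i, m, n⟩ := a
      rw [hw]
      rcases hC j k hjk τ hτ m n with h | ⟨h, h'⟩
      · obtain ⟨e1, e2⟩ := edgeWell_of_edge (M := M) (δ := δ) hp hjk hτ h i
        rw [← hz] at e1 e2
        simp only [edgeSlope2, e1, e2, sub_self, mul_zero, sub_zero, add_zero]
        rcases h with ⟨rfl, rfl⟩ | ⟨rfl, rfl⟩
        · exact le_rfl
        · rw [segSlope2_swap, hsymm]
      · rw [← hz] at h h'
        have q0 := segDist2_nonneg (p m) (p n) z
        have h1 := neg_le_of_abs_le (h i)
        have h2 := mul_le_mul_of_nonneg_right hM q0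
        simp only [edgeSlope2, edgeWell, segWell]
        have h3 : segDist2 (p m) (p n) z ≤ segVal (δ i m) (δ i n) (p m) (p n) z +
            M * segDist2 (p m) (p n) z - segVal (δ i j) (δ i k) (p j) (p k) z := by linarith
        have h4 := mul_le_mul_of_nonneg_left h3 hK0
        have h5 := mul_le_mul_of_nonneg_right hK q0
        linarith
    · have := Finset.le_sup' (fun a : Fin (d + 1) × (Fin (d + 1) × Fin (d + 1)) =>
        edgeSlope2 M p δ a.2 z - K * (edgeWell M p δ a.1 a.2 z - graphCalib M c p δ a.1 z))
        (Finset.mem_univ (j, (j, k)))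
      refine le_trans ?_ this
      have e1 := (edgeWell_of_edge (M := M) (δ := δ) hp hjk hτ (.inl ⟨rfl, rfl⟩) j).1
      rw [← hz] at e1
      simp only [edgeSlope2, hw, e1, hd]
      simp
  rw [graphPot, h1, h2, hs, max_eq_right (by rw [← hs]; exact hs0)]
  simp

theorem exists_le_segDist2 (p : Fin (d + 1) → Fin d → ℝ) (Q : ℝ) :
    ∃ ρ, 0 < ρ ∧ ∀ z, ρ ≤ ‖z‖ → ∀ m n, Q ≤ segDist2 (p m) (p n) z := by
  obtain ⟨P, hP0, hP⟩ := exists_forall_le fun e : Fin (d + 1) × Fin (d + 1) =>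
    ‖p e.1‖ + ‖p e.2 - p e.1‖
  refine ⟨P + 1 + |Q|, by positivity, fun z hz m n => ?_⟩
  have h1 : ‖segFoot (p m) (p n) z‖ ≤ P := by
    refine le_trans ?_ (hP (m, n))
    refine (norm_add_le _ _).trans ?_
    rw [norm_smul, Real.norm_eq_abs, abs_of_nonneg (clamp01_nonneg _)]
    have := mul_le_mul_of_nonneg_right (clamp01_le_one (segCoord (p m) (p n) z))
      (norm_nonneg (p n - p m))
    simp only
    linarith
  have h2 := norm_sub_norm_le z (segFoot (p m) (p n) z)
  have h3 : 1 + |Q| ≤ ‖z - segFoot (p m) (p n) z‖ := by linarith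
  have h4 := norm_sq_le_vnorm2 (z - segFoot (p m) (p n) z)
  have h5 := le_abs_self Q
  have h6 := abs_nonneg Q
  unfold segDist2
  nlinarith

theorem exists_graphPot_eq_one (hM : 1 ≤ M) (hK : 4 * M + 1 ≤ K) (hc0 : 0 ≤ c)
    (hδ : ∀ i j, 0 ≤ δ i j) (hc : ∀ i j, δ i j ≤ c) : ∃ ρ, 0 < ρ ∧ ∀ z, ρ ≤ ‖z‖ →
      graphPot M K c p δ z = 1 ∧ ∀ i, graphCalib M c p δ i z = c := by
  obtain ⟨S, hS0, hS⟩ := exists_forall_le fun e : Fin (d + 1) × Fin (d + 1) =>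
    36 * c ^ 2 * (vnorm2 (p e.2 - p e.1))⁻¹
  have hK1 : 1 ≤ K := by linarith
  obtain ⟨ρ, hρ0, hρ⟩ := exists_le_segDist2 p (S + K * c + 1)
  have hKc : c ≤ K * c := le_mul_of_one_le_left hc0 hK1
  refine ⟨ρ, hρ0, fun z hz => ?_⟩
  have hq := hρ z hz
  have hcal : ∀ i, graphCalib M c p δ i z = c := fun i => by
    refine min_eq_left (Finset.le_inf' _ _ fun e _ => ?_)
    have h1 := segVal_nonneg (hδ i e.1) (hδ i e.2) (p e.1) (p e.2) z
    have h2 := hq e.1 e.2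
    have h3 := mul_le_mul_of_nonneg_right hM (segDist2_nonneg (p e.1) (p e.2) z)
    unfold edgeWell segWell
    linarith
  refine ⟨?_, hcal⟩
  have h1 : graphSlope2 M K c p δ z ≤ 0 := by
    refine Finset.sup'_le _ _ fun a _ => ?_
    obtain ⟨i, m, n⟩ := a
    have h1 := segVal_nonneg (hδ i m) (hδ i n) (p m) (p n) z
    have h2 := hq m n
    have h3 : segSlope2 (δ m n) (p m) (p n) z ≤ S :=
      (segSlope2_le_const (B := c) (by rw [abs_of_nonneg (hδ m n)]; exact hc m n) _ _ _).trans
        (hS (m, n))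
    have q0 := segDist2_nonneg (p m) (p n) z
    rw [hcal]
    simp only [edgeSlope2, edgeWell, segWell]
    have h4 := mul_nonneg (zero_le_one.trans hK1) h1
    have h5 : (4 * M ^ 2 + 1) * segDist2 (p m) (p n) z ≤ K * M * segDist2 (p m) (p n) z := by
      gcongr
      nlinarith
    linarith
  have h2 : 1 ≤ graphDist2 p z := Finset.le_inf' _ _ fun e _ => by
    have := hq e.1 e.2
    have := mul_nonneg (zero_le_one.trans hK1) hc0
    linarith
  rw [graphPot, max_eq_left h1, min_eq_left h2]
  simp

end graph

section zeros

variable {d : ℕ} {p : Fin (d + 1) → Fin d → ℝ} {δ : Fin (d + 1) → Fin (d + 1) → ℝ} {M K c C : ℝ}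

theorem graphCalib_nonneg (hM : 0 ≤ M) (hc : 0 ≤ c) (hδ : ∀ i j, 0 ≤ δ i j) (i : Fin (d + 1))
    (z : Fin d → ℝ) : 0 ≤ graphCalib M c p δ i z :=
  le_min hc (Finset.le_inf' _ _ fun _ _ =>
    add_nonneg (segVal_nonneg (hδ _ _) (hδ _ _) _ _ _) (mul_nonneg hM (segDist2_nonneg _ _ _)))

theorem eq_of_graphCalib_eq_zero (hM : 0 < M) (hc : 0 < c) (hδ : ∀ i j, 0 ≤ δ i j)
    (hpos : ∀ i j, i ≠ j → 0 < δ i j) {i : Fin (d + 1)} {z : Fin d → ℝ}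
    (h : graphCalib M c p δ i z = 0) : z = p i := by
  obtain ⟨⟨m, n⟩, -, he⟩ := Finset.exists_mem_eq_inf' Finset.univ_nonempty
    fun e : Fin (d + 1) × Fin (d + 1) => edgeWell M p δ i e z
  have hzero : ∀ j, δ i j = 0 → j = i := fun j hj => by
    by_contra hne
    exact (hpos i j (Ne.symm hne)).ne' hj
  have h1 : edgeWell M p δ i (m, n) z = 0 := by
    rw [graphCalib, he] at h
    rcases min_choice c (edgeWell M p δ i (m, n) z) with h' | h' <;> rw [h'] at h
    · exact absurd h hc.ne'
    · exact h
  have h2 := segVal_nonneg (hδ i m) (hδ i n) (p m) (p n) z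
  have h3 := mul_nonneg hM.le (segDist2_nonneg (p m) (p n) z)
  simp only [edgeWell, segWell] at h1
  have h4 : segDist2 (p m) (p n) z = 0 := by
    have : M * segDist2 (p m) (p n) z = 0 := by linarith
    exact (mul_eq_zero.1 this).resolve_left hM.ne'
  have h5 : segVal (δ i m) (δ i n) (p m) (p n) z = 0 := by linarith
  have hz := eq_segFoot_of_segDist2_eq_zero h4
  unfold segVal at h5
  unfold segFoot at hz
  have g0 := hermite_nonneg (segCoord (p m) (p n) z)
  have g1 := hermite_le_one (segCoord (p m) (p n) z)
  set g := hermite (segCoord (p m) (p n) z) with hg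
  have k1 := mul_nonneg (hδ i m) (sub_nonneg.2 g1)
  have k2 := mul_nonneg (hδ i n) g0
  have k3 : δ i m * (1 - g) = 0 := by linarith
  have k4 : δ i n * g = 0 := by linarith
  rcases mul_eq_zero.1 k4 with hn | h0
  · have hn' := hzero n hn
    rcases mul_eq_zero.1 k3 with hm | h1
    · have hm' := hzero m hm
      rw [hz, hn', hm']; simp
    · rw [hz, hermite_eq_one (by linarith : g = 1), ← hn']; module
  · rw [h0, sub_zero, mul_one] at k3
    have hm' := hzero m k3
    rw [hz, hermite_eq_zero h0, hm']; simp

theorem exists_eq_of_graphPot_eq_zero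
    (hpos : ∀ i j, i ≠ j → 0 < δ i j)
    (hedge : ∀ j k, j ≠ k → ∀ τ ∈ Set.Icc (0 : ℝ) 1, graphPot M K c p δ (p j + τ • (p k - p j)) =
      1 / 2 * ((δ j k * (6 * (τ * (1 - τ)))) ^ 2 / vnorm2 (p k - p j)))
    (hp : Function.Injective p) {z : Fin d → ℝ} (h : graphPot M K c p δ z = 0) :
    ∃ i, z = p i := by
  obtain ⟨⟨m, n⟩, -, he⟩ := Finset.exists_mem_eq_inf' Finset.univ_nonempty
    fun e : Fin (d + 1) × Fin (d + 1) => segDist2 (p e.1) (p e.2) z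
  have h1 := le_max_left 0 (graphSlope2 M K c p δ z)
  have h2 := le_min zero_le_one (graphDist2_nonneg p z)
  have h3 : min 1 (graphDist2 p z) = 0 := by
    unfold graphPot at h
    linarith
  have h4 : segDist2 (p m) (p n) z = 0 := by
    rw [graphDist2, he] at h3
    rcases min_choice 1 (segDist2 (p m) (p n) z) with h' | h' <;> rw [h'] at h3
    · exact absurd h3 one_ne_zero
    · exact h3
  have hz := eq_segFoot_of_segDist2_eq_zero h4
  unfold segFoot at hz
  set τ := clamp01 (segCoord (p m) (p n) z)
  by_cases hmn : m = n
  · exact ⟨m, by rw [hz, hmn]; simp⟩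
  have hv := vnorm2_sub_pos fun h => hmn (hp h)
  have h5 := hedge m n hmn τ ⟨clamp01_nonneg _, clamp01_le_one _⟩
  rw [← hz, h] at h5
  have h6 : (δ m n * (6 * (τ * (1 - τ)))) ^ 2 = 0 := by
    rcases div_eq_zero_iff.1 (by linarith :
      (δ m n * (6 * (τ * (1 - τ)))) ^ 2 / vnorm2 (p n - p m) = 0) with h | h
    · exact h
    · exact absurd h hv.ne'
  have h7 := (mul_eq_zero.1 (pow_eq_zero_iff two_ne_zero |>.1 h6)).resolve_left (hpos m n hmn).ne'
  have h8 : τ * (1 - τ) = 0 := by linarith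
  rcases mul_eq_zero.1 h8 with h | h
  · exact ⟨m, by rw [hz, h]; simp⟩
  · refine ⟨n, ?_⟩
    rw [hz, show τ = 1 by linarith]
    module

end zeros

/-- A potential with prescribed geodesic distances between its wells, together with its
calibrations. -/
theorem exists_calibrated_potential {d : ℕ} [NeZero d] {p : Fin (d + 1) → Fin d → ℝ}
    (hp : AffineIndependent ℝ p) {δ : Fin (d + 1) → Fin (d + 1) → ℝ}
    (hδ0 : ∀ i, δ i i = 0) (hδpos : ∀ i j, i ≠ j → 0 < δ i j)
    (hδsymm : ∀ i j, δ i j = δ j i) (hδtri : ∀ i j k, δ i j ≤ δ i k + δ k j) :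
    ∃ (W : (Fin d → ℝ) → ℝ) (φ : Fin (d + 1) → (Fin d → ℝ) → ℝ) (ρ c : ℝ), 0 < ρ ∧ 0 < c ∧
      (∃ K : NNReal, LipschitzWith K W) ∧ (∀ z, 0 ≤ W z) ∧
      (∀ z, ρ ≤ ‖z‖ → W z = 1 ∧ ∀ i, φ i z = c) ∧
      (∀ z, W z = 0 ↔ ∃ i, z = p i) ∧
      (∀ j k, j ≠ k → ∀ τ ∈ Set.Icc (0 : ℝ) 1, W (p j + τ • (p k - p j)) =
        1 / 2 * ((δ j k * (6 * (τ * (1 - τ)))) ^ 2 / vnorm2 (p k - p j))) ∧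
      (∀ i, LocallyLipschitz (φ i)) ∧ (∀ i, Calibrates W (φ i)) ∧
      (∀ i j, φ i (p j) = δ i j) ∧ (∀ i z, 0 ≤ φ i z) ∧ (∀ i z, φ i z = 0 → z = p i) := by
  have hδ : ∀ i j, 0 ≤ δ i j := fun i j => by
    by_cases h : i = j
    · rw [h, hδ0]
    · exact (hδpos i j h).le
  have hinj := hp.injective
  obtain ⟨B, hB0, hB⟩ := exists_forall_le fun e : Fin (d + 1) × Fin (d + 1) => δ e.1 e.2
  obtain ⟨C, hC0, hC⟩ := exists_segVal_compare hp hδ (fun i j => hB (i, j)) hδsymm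
  set c := B + 1
  set M := C + 1 with hM
  set K := C + 4 * M ^ 2 + 4 * M + 1
  have hc : ∀ i j, δ i j ≤ c := fun i j => (hB (i, j)).trans (by simp [c])
  have hc0 : 0 < c := by positivity
  have hM0 : 0 < M := by positivity
  have hK0 : 0 < K := by positivity
  obtain ⟨ρ, hρ0, hρ⟩ := exists_graphPot_eq_one (p := p) (M := M) (K := K) (by linarith)
    (by nlinarith) hc0.le hδ hc
  have hedge := fun j k hjk τ hτ => graphPot_edge (K := K) (j := j) (k := k) (τ := τ) hinj hC hM.ge
    hK0.le (by linarith) hδsymm hc hjk hτ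
  have : Nontrivial (Fin (d + 1)) := Fin.nontrivial_iff_two_le.2 (by
    have := NeZero.ne d
    omega)
  refine ⟨graphPot M K c p δ, graphCalib M c p δ, ρ, c, hρ0, hc0,
    exists_lipschitzWith_of_eq_const (locallyLipschitz_graphPot _ _ _ _ _) hρ0.le
      fun z hz => (hρ z hz).1, graphPot_nonneg _ _ _ _ _, hρ, fun z => ⟨fun h =>
        exists_eq_of_graphPot_eq_zero hδpos hedge hinj h, ?_⟩, hedge,
    locallyLipschitz_graphCalib _ _ _ _, calibrates_graphCalib _ _ hM0.le _ fun i m n => ?_, ?_,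
    graphCalib_nonneg hM0.le hc0.le hδ, fun i z h => eq_of_graphCalib_eq_zero hM0 hc0 hδ hδpos h⟩
  · rintro ⟨i, rfl⟩
    obtain ⟨k, hk⟩ := exists_ne i
    have := hedge i k hk.symm 0 ⟨le_rfl, zero_le_one⟩
    simpa using this
  · rw [abs_le]
    constructor
    · linarith [hδtri i m n, hδsymm m n]
    · linarith [hδtri i n m]
  · intro i j
    obtain ⟨k, hk⟩ := exists_ne j
    have := graphCalib_edge hinj hC (by linarith : C ≤ M) hc hk.symm
      (τ := 0) ⟨le_rfl, zero_le_one⟩ i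
    rw [segVal_lineMap fun h => hk (hinj h).symm] at this
    simpa [hermite, clamp01] using this

/-! ### Calibration along absolutely continuous curves -/

theorem vnorm2_le_card_mul {d : ℕ} (v : Fin d → ℝ) : vnorm2 v ≤ d * ‖v‖ ^ 2 := by
  have : ∀ i ∈ Finset.univ, v i ^ 2 ≤ ‖v‖ ^ 2 := fun i _ => by
    rw [← sq_abs]
    have : |v i| ≤ ‖v‖ := norm_le_pi_norm v i
    gcongr
  simpa [vnorm2] using Finset.sum_le_card_nsmul _ _ _ this

theorem sqrt_vnorm2_le {d : ℕ} (v : Fin d → ℝ) : Real.sqrt (vnorm2 v) ≤ Real.sqrt d * ‖v‖ := by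
  rw [Real.sqrt_le_left (by positivity), mul_pow, Real.sq_sqrt (by positivity)]
  exact vnorm2_le_card_mul v

theorem continuous_vnorm2 {d : ℕ} : Continuous (vnorm2 : (Fin d → ℝ) → ℝ) :=
  contDiff_vnorm2.continuous

theorem AbsolutelyContinuousOnInterval.of_dist_le {X Y : Type*} [PseudoMetricSpace X]
    [PseudoMetricSpace Y] {f : ℝ → X} {g : ℝ → Y} {a b K : ℝ} (hK : 0 ≤ K)
    (hg : AbsolutelyContinuousOnInterval g a b)
    (h : ∀ s ∈ Set.uIcc a b, ∀ t ∈ Set.uIcc a b, dist (f s) (f t) ≤ K * dist (g s) (g t)) :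
    AbsolutelyContinuousOnInterval f a b := by
  rw [absolutelyContinuousOnInterval_iff] at *
  intro ε hε
  obtain ⟨η, hη, H⟩ := hg (ε / (K + 1)) (by positivity)
  refine ⟨η, hη, fun E hE hlt => ?_⟩
  have h1 := H E hE hlt
  have h2 : ∑ i ∈ Finset.range E.1, dist (f (E.2 i).1) (f (E.2 i).2) ≤
      K * ∑ i ∈ Finset.range E.1, dist (g (E.2 i).1) (g (E.2 i).2) := by
    rw [Finset.mul_sum]
    exact Finset.sum_le_sum fun i hi => h _ (hE.1 i hi).1 _ (hE.1 i hi).2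
  rw [lt_div_iff₀ (by positivity)] at h1
  have h3 : 0 ≤ ∑ i ∈ Finset.range E.1, dist (g (E.2 i).1) (g (E.2 i).2) :=
    Finset.sum_nonneg fun _ _ => dist_nonneg
  linarith

theorem Calibrates.abs_sub_le {d : ℕ} {W φ : (Fin d → ℝ) → ℝ} (hφ : Calibrates W φ)
    {γ : ℝ → Fin d → ℝ} {a b : ℝ} (hab : a ≤ b)
    (hac : AbsolutelyContinuousOnInterval (fun t => φ (γ t)) a b)
    (hγ : ∀ᵐ t, DifferentiableAt ℝ γ t) {F : ℝ → ℝ} (hF : IntervalIntegrable F volume a b)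
    (hle : ∀ᵐ t, t ∈ Set.Ioc a b →
      Real.sqrt (2 * W (γ t)) * Real.sqrt (vnorm2 (deriv γ t)) ≤ F t) :
    |φ (γ b) - φ (γ a)| ≤ ∫ t in a..b, F t := by
  rw [← hac.integral_deriv_eq_sub, ← Real.norm_eq_abs]
  refine intervalIntegral.norm_integral_le_of_norm_le hab ?_ hF
  filter_upwards [hγ, hac.ae_differentiableAt, hle] with t h1 h2 h3 ht
  have h4 := (h2 (by rw [Set.uIcc_of_le hab]; exact Set.Ioc_subset_Icc_self ht)).hasDerivAt
  exact (hφ γ t _ _ h1.hasDerivAt h4).trans (h3 ht)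

theorem le_geodFull {d : ℕ} {W φ : (Fin d → ℝ) → ℝ} (hW : Continuous W)
    (hlip : LocallyLipschitz φ) (hφ : Calibrates W φ) {γ : ℝ → Fin d → ℝ} {K : NNReal}
    (hγ : LipschitzWith K γ) :
    |φ (γ 1) - φ (γ (-1))| ≤
      ∫ t in Set.Icc (-1 : ℝ) 1, Real.sqrt (2 * W (γ t)) * Real.sqrt (vnorm2 (deriv γ t)) := by
  have hab : (-1 : ℝ) ≤ 1 := by norm_num
  obtain ⟨K', hK'⟩ := LocallyLipschitzOn.exists_lipschitzOnWith_of_compact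
    (isCompact_uIcc (a := (-1 : ℝ)) (b := 1)) (hlip.comp hγ.locallyLipschitz).locallyLipschitzOn
  have hInt : IntegrableOn (fun t => Real.sqrt (2 * W (γ t)) * Real.sqrt (vnorm2 (deriv γ t)))
      (Set.Icc (-1 : ℝ) 1) := by
    have hc := hγ.continuous
    refine Integrable.mul_bdd (c := Real.sqrt d * K)
      (ContinuousOn.integrableOn_Icc (by fun_prop)) ?_ ?_
    · exact (((continuous_vnorm2.measurable.comp (measurable_deriv γ)).sqrt)).aestronglyMeasurable
    · refine Eventually.of_forall fun t => ?_
      rw [Real.norm_of_nonneg (Real.sqrt_nonneg _)]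
      refine (sqrt_vnorm2_le _).trans ?_
      gcongr
      exact norm_deriv_le_of_lipschitz hγ
  rw [integral_Icc_eq_integral_Ioc, ← intervalIntegral.integral_of_le hab]
  refine hφ.abs_sub_le hab hK'.absolutelyContinuousOnInterval hγ.ae_differentiableAt ?_
    (Eventually.of_forall fun t _ => le_rfl)
  rw [intervalIntegrable_iff_integrableOn_Icc_of_le hab]
  exact hInt

theorem geodFull_eq {d : ℕ} {W φ : (Fin d → ℝ) → ℝ} (hW : Continuous W)
    (hlip : LocallyLipschitz φ) (hφ : Calibrates W φ) {x y : Fin d → ℝ} (hxy : x ≠ y) {r : ℝ}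
    (hr : 0 ≤ r) (hedge : ∀ τ ∈ Set.Icc (0 : ℝ) 1, W (x + τ • (y - x)) =
      1 / 2 * ((r * (6 * (τ * (1 - τ)))) ^ 2 / vnorm2 (y - x)))
    (h : |φ y - φ x| = r) : geodFull d W x y = r := by
  have hV := vnorm2_sub_pos hxy
  refine IsLeast.csInf_eq ⟨⟨fun t => x + ((t + 1) / 2) • (y - x), ?_, ?_, ?_, ?_⟩, ?_⟩
  · refine ⟨‖y - x‖₊, LipschitzWith.of_dist_le_mul fun s t => ?_⟩
    rw [dist_add_left, dist_eq_norm, ← sub_smul, norm_smul, mul_comm, coe_nnnorm]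
    gcongr
    rw [Real.dist_eq, Real.norm_eq_abs, show (s + 1) / 2 - (t + 1) / 2 = (s - t) / 2 by ring,
      abs_div, abs_two]
    linarith [abs_nonneg (s - t)]
  · simp
  · norm_num
  · have hderiv : ∀ t : ℝ, HasDerivAt (fun t : ℝ => x + ((t + 1) / 2) • (y - x))
        ((1 / 2 : ℝ) • (y - x)) t := fun t => by
      have h1 : HasDerivAt (fun t : ℝ => (t + 1) / 2) (1 / 2) t :=
        ((hasDerivAt_id t).add_const 1).div_const 2
      exact (h1.smul_const (y - x)).const_add x
    have hprim : ∀ t : ℝ, HasDerivAt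
        (fun t : ℝ => r * (3 * ((t + 1) / 2) ^ 2 - 2 * ((t + 1) / 2) ^ 3))
        (r * (6 * ((t + 1) / 2 * (1 - (t + 1) / 2))) / 2) t := fun t => by
      have h1 : HasDerivAt (fun t : ℝ => (t + 1) / 2) (1 / 2) t :=
        ((hasDerivAt_id t).add_const 1).div_const 2
      refine (((h1.fun_pow 2).const_mul 3).fun_sub ((h1.fun_pow 3).const_mul 2)).const_mul r
        |>.congr_deriv ?_
      simp
      ring
    have hab : (-1 : ℝ) ≤ 1 := by norm_num
    rw [setIntegral_congr_fun measurableSet_Icc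
      (g := fun t => r * (6 * ((t + 1) / 2 * (1 - (t + 1) / 2))) / 2) fun t ht => ?_,
      integral_Icc_eq_integral_Ioc, ← intervalIntegral.integral_of_le hab,
      intervalIntegral.integral_eq_sub_of_hasDerivAt fun t _ => hprim t]
    · norm_num
    · exact (Continuous.intervalIntegrable (by fun_prop) _ _)
    · obtain ⟨h1, h2⟩ := ht
      have hτ : (t + 1) / 2 ∈ Set.Icc (0 : ℝ) 1 := ⟨by linarith, by linarith⟩
      simp only [(hderiv t).deriv, hedge _ hτ]
      have hnn : 0 ≤ r * (6 * ((t + 1) / 2 * (1 - (t + 1) / 2))) :=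
        mul_nonneg hr (mul_nonneg (by norm_num) (mul_nonneg hτ.1 (sub_nonneg.2 hτ.2)))
      rw [vnorm2_smul, ← Real.sqrt_mul (by positivity)]
      rw [show 2 * (1 / 2 * ((r * (6 * ((t + 1) / 2 * (1 - (t + 1) / 2)))) ^ 2 / vnorm2 (y - x))) *
        ((1 / 2) ^ 2 * vnorm2 (y - x)) = (r * (6 * ((t + 1) / 2 * (1 - (t + 1) / 2))) / 2) ^ 2 by
          field_simp]
      exact Real.sqrt_sq (by positivity)
  · rintro L ⟨γ, ⟨K, hγ⟩, h0, h1, rfl⟩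
    have := le_geodFull hW hlip hφ hγ
    rwa [h0, h1, h] at this

theorem geodFull_self {d : ℕ} (W : (Fin d → ℝ) → ℝ) (x : Fin d → ℝ) : geodFull d W x x = 0 := by
  refine IsLeast.csInf_eq ⟨⟨fun _ => x, ⟨0, LipschitzWith.const x⟩, rfl, rfl, ?_⟩, ?_⟩
  · simp [vnorm2]
  · rintro L ⟨γ, -, -, -, rfl⟩
    positivity

/-! ### Slicing the rotated cylinder -/

theorem vnorm2_mulVec {d : ℕ} {R : Matrix (Fin d) (Fin d) ℝ} (hR : R.transpose * R = 1)
    (v : Fin d → ℝ) : vnorm2 (R.mulVec v) = vnorm2 v := by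
  rw [vnorm2_eq_dotProduct, vnorm2_eq_dotProduct, Matrix.dotProduct_mulVec, Matrix.vecMul_mulVec,
    hR, Matrix.vecMul_one]

theorem lintegral_strip {n : ℕ} {f : (Fin (n + 1) → ℝ) → ℝ≥0∞} (hf : Measurable f) :
    ∫⁻ x in strip (n + 1), f x = ∫⁻ y in cube (n + 1), ∫⁻ t : ℝ, f (Function.update y 0 t) := by
  have hmp := (volume_preserving_piFinSuccAbove (fun _ : Fin (n + 1) => ℝ) 0).symm
  set e := (MeasurableEquiv.piFinSuccAbove (fun _ : Fin (n + 1) => ℝ) 0).symm with he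
  have hcube : MeasurableSet (cube n) := MeasurableSet.univ_pi fun _ => measurableSet_Ico
  have hcube' : MeasurableSet (cube (n + 1)) := MeasurableSet.univ_pi fun _ => measurableSet_Ico
  have hstrip : MeasurableSet (strip (n + 1)) := by
    have : strip (n + 1) = ⋂ i : Fin (n + 1), ⋂ _ : i ≠ 0,
        (fun x => x i) ⁻¹' Set.Ico (0 : ℝ) 1 := by
      ext x; simp [strip]
    rw [this]
    exact MeasurableSet.iInter fun i => MeasurableSet.iInter fun _ =>
      measurable_pi_apply i measurableSet_Ico
  have hes : ∀ w : ℝ × (Fin n → ℝ), e w 0 = w.1 ∧ ∀ i : Fin n, e w i.succ = w.2 i := fun w => by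
    simp [he, MeasurableEquiv.piFinSuccAbove]
  have hup : ∀ (w : ℝ × (Fin n → ℝ)) (t : ℝ), Function.update (e w) 0 t = e (t, w.2) := by
    intro w t
    ext i
    refine Fin.cases ?_ (fun i => ?_) i
    · simp [(hes _).1]
    · rw [Function.update_of_ne (Fin.succ_ne_zero i), (hes _).2, (hes _).2]
  have hpre1 : e ⁻¹' strip (n + 1) = Set.univ ×ˢ cube n := by
    ext w
    simp only [strip, cube, Set.mem_preimage, Set.mem_ofPred_eq, Set.mem_prod, Set.mem_univ,
      true_and, Set.mem_pi, Fin.forall_fin_succ, ne_eq, not_true_eq_false, false_implies,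
      Fin.succ_ne_zero, not_false_eq_true, forall_const, (hes w).2]
  have hpre2 : e ⁻¹' cube (n + 1) = Set.Ico (0 : ℝ) 1 ×ˢ cube n := by
    ext w
    simp only [cube, Set.mem_preimage, Set.mem_prod, Set.mem_univ,
      Set.mem_pi, Fin.forall_fin_succ, forall_const, (hes w).2, (hes w).1]
  have hm : Measurable fun w : ℝ × (Fin n → ℝ) => f (e w) := hf.comp e.measurable
  have hm2 : Measurable fun y : Fin n → ℝ => ∫⁻ t : ℝ, f (e (t, y)) := hm.lintegral_prod_left'
  have hG : Measurable fun y : Fin (n + 1) → ℝ => ∫⁻ t : ℝ, f (Function.update y 0 t) := by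
    have : Measurable fun w : (Fin (n + 1) → ℝ) × ℝ => f (Function.update w.1 0 w.2) :=
      hf.comp measurable_update'
    exact this.lintegral_prod_right'
  rw [← hmp.setLIntegral_comp_preimage hstrip hf, ← hmp.setLIntegral_comp_preimage hcube' hG,
    hpre1, hpre2]
  simp only [hup]
  have hm3 : Measurable fun a : ℝ × (Fin n → ℝ) => ∫⁻ t : ℝ, f (e (t, a.2)) :=
    hm2.comp measurable_snd
  rw [Measure.volume_eq_prod, ← Measure.prod_restrict, ← Measure.prod_restrict,
    lintegral_prod_symm _ hm.aemeasurable, Measure.restrict_univ,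
    lintegral_prod _ hm3.aemeasurable]
  simp

theorem measurePreserving_mulVec {d : ℕ} {Q : Matrix (Fin d) (Fin d) ℝ} (hQ : |Q.det| = 1) :
    MeasurePreserving (fun y : Fin d → ℝ => Q.mulVec y) := by
  have h0 : Q.det ≠ 0 := fun h => by simp [h] at hQ
  refine ⟨(Continuous.matrix_mulVec continuous_const continuous_id).measurable, ?_⟩
  have := Real.map_matrix_volume_pi_eq_smul_volume_pi h0
  rw [abs_inv, hQ] at this
  rw [inv_one, ENNReal.ofReal_one, one_smul] at this
  exact this

theorem measurableSet_strip (d : ℕ) [NeZero d] : MeasurableSet (strip d) := by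
  have : strip d = ⋂ i : Fin d, ⋂ _ : i ≠ 0,
        (fun x => x i) ⁻¹' Set.Ico (0 : ℝ) 1 := by
    ext x; simp [strip]
  rw [this]
  exact MeasurableSet.iInter fun i => MeasurableSet.iInter fun _ =>
    measurable_pi_apply i measurableSet_Ico

theorem measurableSet_stripR {d : ℕ} [NeZero d] (R : Matrix (Fin d) (Fin d) ℝ) :
    MeasurableSet (stripR d R) :=
  (Continuous.matrix_mulVec continuous_const continuous_id).measurable (measurableSet_strip d)

theorem volume_cube (d : ℕ) : volume (cube d) = 1 := by
  simp [cube, volume_pi_pi]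

instance isProbabilityMeasure_cube (d : ℕ) :
    IsProbabilityMeasure ((volume : Measure (Fin d → ℝ)).restrict (cube d)) :=
  ⟨by simp [volume_cube]⟩

theorem abs_det_transpose_eq_one {d : ℕ} {R : Matrix (Fin d) (Fin d) ℝ} (hdet : R.det = 1) :
    |R.transpose.det| = 1 := by simp [hdet]

theorem lintegral_stripR {d : ℕ} [NeZero d] {R : Matrix (Fin d) (Fin d) ℝ}
    (hR : R.transpose * R = 1) (hdet : R.det = 1) {f : (Fin d → ℝ) → ℝ≥0∞} (hf : Measurable f) :
    ∫⁻ x in stripR d R, f x =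
      ∫⁻ y in cube d, ∫⁻ t : ℝ, f (R.transpose.mulVec (Function.update y 0 t)) := by
  have hmp := measurePreserving_mulVec (abs_det_transpose_eq_one hdet)
  have hpre : (fun y : Fin d → ℝ => R.transpose.mulVec y) ⁻¹' stripR d R = strip d := by
    ext y
    simp [stripR, Matrix.mulVec_mulVec, mul_eq_one_comm.mp hR]
  rw [← hmp.setLIntegral_comp_preimage (measurableSet_stripR R) hf, hpre]
  have hf' := hf.comp hmp.measurable
  obtain ⟨n, rfl⟩ := Nat.exists_eq_succ_of_ne_zero (NeZero.ne d)
  exact lintegral_strip hf'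

/-! ### The energy density -/

theorem gradSq_eq_sum {d : ℕ} (u : (Fin d → ℝ) → Fin d → ℝ) (x : Fin d → ℝ) :
    gradSq u x = ∑ i, vnorm2 (pd i u x) := rfl

theorem gradSq_nonneg {d : ℕ} (u : (Fin d → ℝ) → Fin d → ℝ) (x : Fin d → ℝ) :
    0 ≤ gradSq u x :=
  Finset.sum_nonneg fun _ _ => vnorm2_nonneg _

theorem measurable_gradSq {d : ℕ} (u : (Fin d → ℝ) → Fin d → ℝ) : Measurable (gradSq u) := by
  unfold gradSq pd
  refine Finset.measurable_sum _ fun i _ => Finset.measurable_sum _ fun j _ => ?_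
  exact ((measurable_pi_apply j).comp (measurable_fderiv_apply_const ℝ u _)).pow_const 2

theorem measurable_eden {d : ℕ} {W : (Fin d → ℝ) → ℝ} (hW : Continuous W)
    {u : (Fin d → ℝ) → Fin d → ℝ} (hu : Continuous u) : Measurable (eden W u) :=
  ((measurable_gradSq u).const_mul _).add (hW.comp hu).measurable

theorem fderiv_apply_eq_sum_pd {d : ℕ} (u : (Fin d → ℝ) → Fin d → ℝ) (x v : Fin d → ℝ) :
    fderiv ℝ u x v = ∑ i, v i • pd i u x := by
  conv_lhs => rw [pi_eq_sum_univ' v]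
  simp [pd, map_sum]

/-- The Frobenius norm of the Jacobian computed in a rotated basis. -/
theorem gradSq_eq_sum_rotated {d : ℕ} {R : Matrix (Fin d) (Fin d) ℝ}
    (hR : R.transpose * R = 1) (u : (Fin d → ℝ) → Fin d → ℝ) (x : Fin d → ℝ) :
    gradSq u x = ∑ k, vnorm2 (fderiv ℝ u x (R.transpose.mulVec (Pi.single k 1))) := by
  have h : ∀ k j, fderiv ℝ u x (R.transpose.mulVec (Pi.single k 1)) j
      = R.mulVec (fun i => pd i u x j) k := by
    intro k j
    rw [fderiv_apply_eq_sum_pd]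
    simp [Matrix.mulVec, dotProduct, Pi.single_apply]
  calc gradSq u x = ∑ j, vnorm2 (fun i => pd i u x j) := Finset.sum_comm
    _ = ∑ j, vnorm2 (R.mulVec fun i => pd i u x j) := by simp_rw [vnorm2_mulVec hR]
    _ = _ := by
      simp_rw [vnorm2, h]
      exact Finset.sum_comm

theorem transpose_mulVec_single_zero {d : ℕ} [NeZero d] {R : Matrix (Fin d) (Fin d) ℝ}
    (hR : R.transpose * R = 1) {ν : Fin d → ℝ} (hν : R.mulVec ν = Pi.single 0 1) :
    R.transpose.mulVec (Pi.single 0 1) = ν := by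
  rw [← hν, Matrix.mulVec_mulVec, hR, Matrix.one_mulVec]

theorem transpose_mulVec_dotProduct {d : ℕ} [NeZero d] {R : Matrix (Fin d) (Fin d) ℝ}
    {ν : Fin d → ℝ} (hν : R.mulVec ν = Pi.single 0 1) (w : Fin d → ℝ) :
    R.transpose.mulVec w ⬝ᵥ ν = w 0 := by
  rw [Matrix.mulVec_transpose, ← Matrix.dotProduct_mulVec, hν]
  simp

theorem transpose_mulVec_update {d : ℕ} [NeZero d] {R : Matrix (Fin d) (Fin d) ℝ}
    (hR : R.transpose * R = 1) {ν : Fin d → ℝ} (hν : R.mulVec ν = Pi.single 0 1)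
    (y : Fin d → ℝ) (t : ℝ) : R.transpose.mulVec (Function.update y 0 t) =
      R.transpose.mulVec (Function.update y 0 0) + t • ν := by
  have : Function.update y 0 t = Function.update y 0 0 + t • Pi.single (0 : Fin d) (1 : ℝ) := by
    ext i
    by_cases h : i = 0
    · subst h; simp
    · simp [h]
  rw [this, Matrix.mulVec_add, Matrix.mulVec_smul, transpose_mulVec_single_zero hR hν]

/-! ### One-dimensional profiles -/

theorem lintegral_ofReal_of_hasDerivAt {F f : ℝ → ℝ} {m n : ℝ} (hF : ∀ t, HasDerivAt F (f t) t)
    (hf : Continuous f) (h0 : ∀ t, 0 ≤ f t) (hm : Tendsto F atBot (𝓝 m))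
    (hn : Tendsto F atTop (𝓝 n)) : ∫⁻ t, ENNReal.ofReal (f t) = ENNReal.ofReal (n - m) := by
  refine (aecover_Ioc (tendsto_neg_atTop_atBot (G := ℝ)) tendsto_id).lintegral_eq_of_tendsto _
    hf.measurable.ennreal_ofReal.aemeasurable ?_
  refine ((ENNReal.continuous_ofReal.tendsto _).comp
    (hn.sub (hm.comp tendsto_neg_atTop_atBot))).congr' ?_
  filter_upwards [eventually_ge_atTop 0] with s hs
  have hs' : -s ≤ s := by linarith
  simp only [id]
  rw [← ofReal_integral_eq_lintegral_ofReal, ← intervalIntegral.integral_of_le hs',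
    intervalIntegral.integral_eq_sub_of_hasDerivAt (fun t _ => hF t) (hf.intervalIntegrable _ _)]
  · rfl
  · exact (hf.intervalIntegrable _ _).1
  · exact Eventually.of_forall h0

theorem hasFDerivAt_profile {d : ℕ} {g : ℝ → Fin d → ℝ} {g' : Fin d → ℝ} (ν x : Fin d → ℝ)
    (hg : HasDerivAt g g' (x ⬝ᵥ ν)) :
    ∀ w, fderiv ℝ (fun x => g (x ⬝ᵥ ν)) x w = (w ⬝ᵥ ν) • g' ∧
      DifferentiableAt ℝ (fun x => g (x ⬝ᵥ ν)) x := by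
  intro w
  let L : (Fin d → ℝ) →L[ℝ] ℝ := ∑ i, ν i • ContinuousLinearMap.proj (R := ℝ) (φ := fun _ => ℝ) i
  have hL : ∀ w, L w = w ⬝ᵥ ν := fun w => by simp [L, dotProduct, mul_comm]
  have h1 : HasFDerivAt (fun x => x ⬝ᵥ ν) L x := by
    have := L.hasFDerivAt (x := x)
    rwa [show ⇑L = fun x => x ⬝ᵥ ν from funext hL] at this
  have h2 := HasFDerivAt.comp (g := g) (f := fun x => x ⬝ᵥ ν) x hg.hasFDerivAt h1
  refine ⟨?_, h2.differentiableAt⟩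
  have h3 := h2.fderiv
  simp only [Function.comp_def] at h3
  rw [h3]
  simp [hL]

theorem dotProduct_transpose_single {d : ℕ} [NeZero d] {R : Matrix (Fin d) (Fin d) ℝ}
    {ν : Fin d → ℝ} (hν : R.mulVec ν = Pi.single 0 1) {k : Fin d} (hk : k ≠ 0) :
    R.transpose.mulVec (Pi.single k 1) ⬝ᵥ ν = 0 := by
  rw [transpose_mulVec_dotProduct hν, Pi.single_eq_of_ne hk.symm]

section Profile

variable {d : ℕ} {W : (Fin d → ℝ) → ℝ} {R : Matrix (Fin d) (Fin d) ℝ}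
  {ν : Fin d → ℝ} {g g' : ℝ → Fin d → ℝ}

theorem eden_profile (hν1 : vnorm2 ν = 1) (hg : ∀ t, HasDerivAt g (g' t) t) (x : Fin d → ℝ) :
    eden W (fun x => g (x ⬝ᵥ ν)) x
      = 1 / 2 * vnorm2 (g' (x ⬝ᵥ ν)) + W (g (x ⬝ᵥ ν)) := by
  rw [eden, gradSq_eq_sum]
  congr 2
  calc _ = ∑ i, ν i ^ 2 * vnorm2 (g' (x ⬝ᵥ ν)) := by
        refine Finset.sum_congr rfl fun i _ => ?_
        rw [pd, ((hasFDerivAt_profile ν x (hg _)) _).1, vnorm2_smul]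
        simp
    _ = vnorm2 ν * vnorm2 (g' (x ⬝ᵥ ν)) := (Finset.sum_mul _ _ _).symm
    _ = _ := by rw [hν1, one_mul]

variable [NeZero d]

theorem energyR_profile (hR : R.transpose * R = 1) (hdet : R.det = 1)
    (hν : R.mulVec ν = Pi.single 0 1) (hν1 : vnorm2 ν = 1) (hW : Continuous W)
    (hg : ∀ t, HasDerivAt g (g' t) t) :
    energyR d W R (fun x => g (x ⬝ᵥ ν))
      = ∫⁻ t, ENNReal.ofReal (1 / 2 * vnorm2 (g' t) + W (g t)) := by
  have hgc : Continuous g := continuous_iff_continuousAt.mpr fun t => (hg t).continuousAt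
  have hc : Continuous fun x : Fin d → ℝ => g (x ⬝ᵥ ν) :=
    hgc.comp (by unfold dotProduct; fun_prop)
  rw [energyR, lintegral_stripR hR hdet (measurable_eden hW hc).ennreal_ofReal]
  simp_rw [eden_profile hν1 hg, transpose_mulVec_dotProduct hν, Function.update_self]
  rw [lintegral_const]
  simp

theorem admR_profile (hR : R.transpose * R = 1) (hdet : R.det = 1)
    (hν : R.mulVec ν = Pi.single 0 1) (hν1 : vnorm2 ν = 1) (hW : Continuous W)
    (hW0 : ∀ z, 0 ≤ W z) (hg : ∀ t, HasDerivAt g (g' t) t) (hdiv : ∀ t, ν ⬝ᵥ g' t = 0)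
    (hE : ∫⁻ t, ENNReal.ofReal (1 / 2 * vnorm2 (g' t) + W (g t)) ≠ ∞) :
    AdmR d R (fun x => g (x ⬝ᵥ ν)) := by
  refine ⟨fun x => ((hasFDerivAt_profile ν x (hg _)) 0).2, fun x k hk => ?_, fun x => ?_, ?_⟩
  · simp only [add_dotProduct, dotProduct_transpose_single hν hk, add_zero]
  · rw [← hdiv (x ⬝ᵥ ν), dotProduct]
    refine Finset.sum_congr rfl fun i _ => ?_
    rw [pd, ((hasFDerivAt_profile ν x (hg _)) _).1]
    simp
  · refine ⟨(measurable_gradSq _).aestronglyMeasurable, ?_⟩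
    rw [hasFiniteIntegral_iff_ofReal (Eventually.of_forall fun x => gradSq_nonneg _ x)]
    rw [← energyR_profile hR hdet hν hν1 hW hg] at hE
    calc _ ≤ ∫⁻ x in stripR d R, 2 * ENNReal.ofReal (eden W (fun x => g (x ⬝ᵥ ν)) x) := by
          refine lintegral_mono fun x => ?_
          rw [← ENNReal.ofReal_ofNat, ← ENNReal.ofReal_mul (by norm_num)]
          refine ENNReal.ofReal_le_ofReal ?_
          have := hW0 (g (x ⬝ᵥ ν))
          simp only [eden]
          linarith
      _ = 2 * energyR d W R (fun x => g (x ⬝ᵥ ν)) := lintegral_const_mul' _ _ (by simp)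
      _ < ∞ := ENNReal.mul_lt_top (by simp) hE.lt_top

theorem avgR_profile (hν : R.mulVec ν = Pi.single 0 1) :
    avgR d R (fun x => g (x ⬝ᵥ ν)) = g := by
  ext1 t
  rw [avgR]
  simp_rw [transpose_mulVec_dotProduct hν, Function.update_self]
  simp

end Profile

theorem exists_competitor {d : ℕ} [NeZero d] {W : (Fin d → ℝ) → ℝ}
    {R : Matrix (Fin d) (Fin d) ℝ} {ν a b : Fin d → ℝ} {r : ℝ}
    (hR : R.transpose * R = 1) (hdet : R.det = 1)
    (hν : R.mulVec ν = Pi.single 0 1) (hν1 : vnorm2 ν = 1) (hW : Continuous W)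
    (hW0 : ∀ z, 0 ≤ W z) (hab : a ≠ b) (hr : 0 < r) (hνab : ν ⬝ᵥ (b - a) = 0)
    (hedge : ∀ τ ∈ Set.Icc (0 : ℝ) 1,
      W (a + τ • (b - a)) = 1 / 2 * ((r * (6 * (τ * (1 - τ)))) ^ 2 / vnorm2 (b - a))) :
    ∃ v, AdmR d R v ∧ Tendsto (avgR d R v) atBot (𝓝 a) ∧ Tendsto (avgR d R v) atTop (𝓝 b) ∧
      energyR d W R v = ENNReal.ofReal r := by
  have hV := vnorm2_sub_pos hab
  set V := vnorm2 (b - a) with hVdef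
  set k := 6 * r / V with hk
  have hkpos : 0 < k := by positivity
  set s : ℝ → ℝ := fun t => Real.sigmoid (k * t) with hs
  have hsc : Continuous s := continuous_sigmoid.comp (continuous_const.mul continuous_id)
  have hs' : ∀ t, HasDerivAt s (k * (s t * (1 - s t))) t := by
    intro t
    have := (Real.hasDerivAt_sigmoid (k * t)).comp t ((hasDerivAt_id t).const_mul k)
    exact this.congr_deriv (by simp only [hs]; ring)
  have hst : Tendsto s atTop (𝓝 1) :=
    Real.tendsto_sigmoid_atTop.comp (tendsto_id.const_mul_atTop hkpos)
  have hsb : Tendsto s atBot (𝓝 0) :=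
    Real.tendsto_sigmoid_atBot.comp (tendsto_id.const_mul_atBot hkpos)
  set g : ℝ → Fin d → ℝ := fun t => a + s t • (b - a) with hgdef
  set g' : ℝ → Fin d → ℝ := fun t => (k * (s t * (1 - s t))) • (b - a) with hg'def
  have hg : ∀ t, HasDerivAt g (g' t) t := fun t => ((hs' t).smul_const _).const_add _
  have hdens : ∀ t, 1 / 2 * vnorm2 (g' t) + W (g t) = r * (6 * k * s t ^ 2 * (1 - s t) ^ 2) := by
    intro t
    rw [hgdef, hedge (s t) ⟨Real.sigmoid_nonneg _, Real.sigmoid_le_one _⟩, hg'def]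
    simp only [vnorm2_smul, ← hVdef]
    rw [hk]
    field_simp
    ring
  have hE : ∫⁻ t, ENNReal.ofReal (1 / 2 * vnorm2 (g' t) + W (g t)) = ENNReal.ofReal r := by
    simp_rw [hdens]
    have := lintegral_ofReal_of_hasDerivAt (F := fun t => r * (3 * s t ^ 2 - 2 * s t ^ 3))
      (f := fun t => r * (6 * k * s t ^ 2 * (1 - s t) ^ 2)) (m := r * (3 * 0 ^ 2 - 2 * 0 ^ 3))
      (n := r * (3 * 1 ^ 2 - 2 * 1 ^ 3)) (fun t => ?_) (by fun_prop) (fun t => by positivity) ?_ ?_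
    · rw [this]; norm_num
    · have := ((((hs' t).pow 2).const_mul 3).sub (((hs' t).pow 3).const_mul 2)).const_mul r
      exact this.congr_deriv (by norm_num [-mul_eq_mul_left_iff]; ring)
    · exact (((hsb.pow 2).const_mul 3).sub ((hsb.pow 3).const_mul 2)).const_mul r
    · exact (((hst.pow 2).const_mul 3).sub ((hst.pow 3).const_mul 2)).const_mul r
  refine ⟨fun x => g (x ⬝ᵥ ν), admR_profile hR hdet hν hν1 hW hW0 hg (fun t => ?_) ?_, ?_, ?_, ?_⟩
  · simp only [hg'def, dotProduct_smul, hνab, smul_zero]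
  · rw [hE]; simp
  · rw [avgR_profile hν]
    simpa using (hsb.smul_const (b - a)).const_add a
  · rw [avgR_profile hν]
    simpa using (hst.smul_const (b - a)).const_add a
  · rw [energyR_profile hR hdet hν hν1 hW hg, hE]

theorem exists_competitor_self {d : ℕ} [NeZero d] {W : (Fin d → ℝ) → ℝ}
    {R : Matrix (Fin d) (Fin d) ℝ} {ν a : Fin d → ℝ}
    (hR : R.transpose * R = 1) (hdet : R.det = 1)
    (hν : R.mulVec ν = Pi.single 0 1) (hν1 : vnorm2 ν = 1) (hW : Continuous W)
    (hW0 : ∀ z, 0 ≤ W z) (ha : W a = 0) :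
    ∃ v, AdmR d R v ∧ Tendsto (avgR d R v) atBot (𝓝 a) ∧ Tendsto (avgR d R v) atTop (𝓝 a) ∧
      energyR d W R v = 0 := by
  have hg : ∀ t : ℝ, HasDerivAt (fun _ => a) (0 : Fin d → ℝ) t := fun t => hasDerivAt_const _ _
  have hE : ∫⁻ _ : ℝ, ENNReal.ofReal (1 / 2 * vnorm2 (0 : Fin d → ℝ) + W a) = 0 := by
    simp [ha, vnorm2]
  refine ⟨fun x => (fun _ : ℝ => a) (x ⬝ᵥ ν),
    admR_profile hR hdet hν hν1 hW hW0 hg (fun t => by simp) (by rw [hE]; simp), ?_, ?_, ?_⟩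
  · rw [avgR_profile (g := fun _ => a) hν]; exact tendsto_const_nhds
  · rw [avgR_profile (g := fun _ => a) hν]; exact tendsto_const_nhds
  · rw [energyR_profile hR hdet hν hν1 hW hg, hE]

/-! ### Directions of constancy -/

theorem periodic_of_fderiv_apply_eq_zero {d : ℕ} {u : (Fin d → ℝ) → Fin d → ℝ}
    (hu : Differentiable ℝ u) {v : Fin d → ℝ} (h : ∀ᵐ x, fderiv ℝ u x v = 0) :
    Function.Periodic u v := by
  have hm : MeasurableSet {x | fderiv ℝ u x v = 0} :=
    measurable_fderiv_apply_const ℝ u v (measurableSet_singleton 0)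
  have h1 : ∀ᵐ t : ℝ, ∀ᵐ x : Fin d → ℝ, fderiv ℝ u (x + t • v) v = 0 :=
    Eventually.of_forall fun t =>
      (measurePreserving_add_right volume (t • v)).quasiMeasurePreserving.ae h
  have h2 : ∀ᵐ x : Fin d → ℝ, ∀ᵐ t : ℝ, fderiv ℝ u (x + t • v) v = 0 := by
    refine (Measure.ae_ae_comm ?_).mpr h1
    exact (by fun_prop : Measurable fun q : (Fin d → ℝ) × ℝ => q.1 + q.2 • v) hm
  have h3 : (fun x => u (x + v)) =ᵐ[volume] u := by
    filter_upwards [h2] with x hx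
    have hd : ∀ t : ℝ, HasDerivAt (fun t : ℝ => u (x + t • v)) (fderiv ℝ u (x + t • v) v) t := by
      intro t
      have hl : HasDerivAt (fun t : ℝ => x + t • v) v t := by
        simpa using ((hasDerivAt_id t).smul_const v).const_add x
      exact (hu _).hasFDerivAt.comp_hasDerivAt t hl
    have hz : (fun t : ℝ => fderiv ℝ u (x + t • v) v) =ᵐ[volume] fun _ => 0 := hx
    have hInt : IntervalIntegrable (fun t : ℝ => fderiv ℝ u (x + t • v) v) volume 0 1 :=
      (intervalIntegrable_const (c := (0 : Fin d → ℝ))).congr_ae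
        (ae_restrict_of_ae (hz.symm))
    have := intervalIntegral.integral_eq_sub_of_hasDerivAt (fun t _ => hd t) hInt
    rw [intervalIntegral.integral_congr_ae (g := fun _ => 0) (hx.mono fun t ht _ => ht)] at this
    simp only [intervalIntegral.integral_zero, one_smul, zero_smul, add_zero] at this
    exact sub_eq_zero.mp this.symm
  exact congrFun ((Continuous.ae_eq_iff_eq volume
    (hu.continuous.comp (continuous_id.add continuous_const)) hu.continuous).mp h3)

theorem Function.Periodic.sum {α β ι : Type*} [AddCommMonoid α] {u : α → β} {w : ι → α}
    {s : Finset ι} (h : ∀ k ∈ s, Function.Periodic u (w k)) :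
    Function.Periodic u (∑ k ∈ s, w k) :=
  Finset.sum_induction w (Function.Periodic u) (fun _ _ ha hb => ha.add_period hb)
    (fun x => by rw [add_zero]) h

theorem transpose_mulVec_eq_sum {d : ℕ} (R : Matrix (Fin d) (Fin d) ℝ) (m : Fin d → ℝ) :
    R.transpose.mulVec m = ∑ k, m k • R.transpose.mulVec (Pi.single k 1) := by
  conv_lhs => rw [pi_eq_sum_univ' m]
  rw [Matrix.mulVec_sum]
  simp_rw [Matrix.mulVec_smul]

theorem ae_of_ae_stripR {d : ℕ} [NeZero d] {R : Matrix (Fin d) (Fin d) ℝ}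
    (hR : R.transpose * R = 1) {P : (Fin d → ℝ) → Prop}
    (hP : ∀ k : Fin d, k ≠ 0 → Function.Periodic P (R.transpose.mulVec (Pi.single k 1)))
    (h : ∀ᵐ x ∂volume.restrict (stripR d R), P x) : ∀ᵐ x, P x := by
  rw [ae_restrict_iff' (measurableSet_stripR R)] at h
  have h1 : ∀ᵐ x : Fin d → ℝ, ∀ m : Fin d → ℤ,
      x - R.transpose.mulVec (fun k => (m k : ℝ)) ∈ stripR d R →
        P (x - R.transpose.mulVec fun k => (m k : ℝ)) :=
    ae_all_iff.mpr fun m =>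
      (measurePreserving_sub_right volume
        (R.transpose.mulVec fun k => (m k : ℝ))).quasiMeasurePreserving.ae h
  filter_upwards [h1] with x hx
  let m : Fin d → ℤ := fun k => if k = 0 then 0 else ⌊R.mulVec x k⌋
  have hper : Function.Periodic P (R.transpose.mulVec fun k => (m k : ℝ)) := by
    rw [transpose_mulVec_eq_sum]
    refine Function.Periodic.sum fun k _ => ?_
    by_cases hk : k = 0
    · intro y; simp [m, hk]
    · rw [Int.cast_smul_eq_zsmul]
      exact (hP k hk).zsmul (m k)
  have hmem : x - R.transpose.mulVec (fun k => (m k : ℝ)) ∈ stripR d R := by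
    intro k hk
    rw [Matrix.mulVec_sub, Matrix.mulVec_mulVec, mul_eq_one_comm.mp hR, Matrix.one_mulVec]
    simp only [Pi.sub_apply, m, if_neg hk]
    exact ⟨by linarith [Int.floor_le (R.mulVec x k)],
      by linarith [Int.lt_floor_add_one (R.mulVec x k)]⟩
  have := hx m hmem
  rwa [hper.sub_eq] at this

theorem periodic_fderiv_apply {d : ℕ} {u : (Fin d → ℝ) → Fin d → ℝ} {a : Fin d → ℝ}
    (h : Function.Periodic u a) (v : Fin d → ℝ) :
    Function.Periodic (fun x => fderiv ℝ u x v = 0) a := by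
  intro x
  have : fderiv ℝ u (x + a) = fderiv ℝ u x := by
    rw [← fderiv_comp_add_right, funext h]
  simp only [this]

/-- A map on the rotated cylinder whose transversal derivatives vanish a.e. is one-dimensional. -/
theorem eq_profile_of_fderiv_eq_zero {d : ℕ} [NeZero d] {R : Matrix (Fin d) (Fin d) ℝ}
    (hR : R.transpose * R = 1) {ν : Fin d → ℝ} (hν : R.mulVec ν = Pi.single 0 1)
    {u : (Fin d → ℝ) → Fin d → ℝ} (hu : Differentiable ℝ u) (hper : IsPeriodicR d R u)
    (h : ∀ k : Fin d, k ≠ 0 → ∀ᵐ x ∂volume.restrict (stripR d R),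
      fderiv ℝ u x (R.transpose.mulVec (Pi.single k 1)) = 0) (x : Fin d → ℝ) :
    u x = u ((x ⬝ᵥ ν) • ν) := by
  have h1 : ∀ k : Fin d, k ≠ 0 → ∀ c : ℝ,
      Function.Periodic u (c • R.transpose.mulVec (Pi.single k 1)) := by
    intro k hk c
    refine periodic_of_fderiv_apply_eq_zero hu ?_
    have := ae_of_ae_stripR hR
      (fun j hj => periodic_fderiv_apply (fun x => hper x j hj) _) (h k hk)
    filter_upwards [this] with x hx
    rw [map_smul, hx, smul_zero]
  have hx : x = (x ⬝ᵥ ν) • ν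
      + ∑ k ∈ Finset.univ.erase 0, R.mulVec x k • R.transpose.mulVec (Pi.single k 1) := by
    have h2 : x = R.transpose.mulVec (R.mulVec x) := by
      rw [Matrix.mulVec_mulVec, hR, Matrix.one_mulVec]
    have h0 : R.mulVec x 0 = x ⬝ᵥ ν := by
      conv_rhs => rw [h2]
      rw [transpose_mulVec_dotProduct hν]
    conv_lhs => rw [h2, transpose_mulVec_eq_sum, ← Finset.add_sum_erase _ _ (Finset.mem_univ 0)]
    rw [transpose_mulVec_single_zero hR hν, h0]
  conv_lhs => rw [hx]
  exact Function.Periodic.sum (fun k hk => h1 k (Finset.ne_of_mem_erase hk) _) _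

/-! ### Curves of finite energy -/

/-- The energy density `½|γ'|² + W(γ)` of a curve. -/
def curveDensity {d : ℕ} (W : (Fin d → ℝ) → ℝ) (γ : ℝ → Fin d → ℝ) (t : ℝ) : ℝ :=
  1 / 2 * vnorm2 (deriv γ t) + W (γ t)

theorem curveDensity_nonneg {d : ℕ} {W : (Fin d → ℝ) → ℝ} (hW0 : ∀ z, 0 ≤ W z)
    (γ : ℝ → Fin d → ℝ) (t : ℝ) : 0 ≤ curveDensity W γ t :=
  add_nonneg (mul_nonneg (by norm_num) (vnorm2_nonneg _)) (hW0 _)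

theorem sqrt_mul_sqrt_le_curveDensity {d : ℕ} {W : (Fin d → ℝ) → ℝ} (hW0 : ∀ z, 0 ≤ W z)
    (γ : ℝ → Fin d → ℝ) (t : ℝ) :
    Real.sqrt (2 * W (γ t)) * Real.sqrt (vnorm2 (deriv γ t)) ≤ curveDensity W γ t := by
  have h1 := Real.sq_sqrt (show 0 ≤ 2 * W (γ t) by linarith [hW0 (γ t)])
  have h2 := Real.sq_sqrt (vnorm2_nonneg (deriv γ t))
  have := sq_nonneg (Real.sqrt (2 * W (γ t)) - Real.sqrt (vnorm2 (deriv γ t)))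
  rw [curveDensity]
  nlinarith

theorem absolutelyContinuousOnInterval_of_curveDensity {d : ℕ} {W φ : (Fin d → ℝ) → ℝ}
    (hW0 : ∀ z, 0 ≤ W z) (hlip : LocallyLipschitz φ) {γ : ℝ → Fin d → ℝ}
    (hγ : Differentiable ℝ γ) (hE : Integrable (curveDensity W γ)) (a b : ℝ) :
    AbsolutelyContinuousOnInterval (fun t => φ (γ t)) a b := by
  have hInt : ∀ s t, IntervalIntegrable (fun r => ‖deriv γ r‖) volume s t := by
    intro s t
    have h1 : IntervalIntegrable (fun r => 1 + 2 * curveDensity W γ r) volume s t :=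
      intervalIntegrable_const.add ((hE.const_mul 2).intervalIntegrable)
    refine h1.mono_fun (measurable_deriv γ).norm.aestronglyMeasurable
      (Eventually.of_forall fun r => ?_)
    simp only [norm_norm]
    refine le_trans ?_ (le_abs_self _)
    have h2 := norm_sq_le_vnorm2 (deriv γ r)
    have h3 := hW0 (γ r)
    rw [curveDensity]
    nlinarith [sq_nonneg (‖deriv γ r‖ - 1)]
  obtain ⟨K, hK⟩ := LocallyLipschitzOn.exists_lipschitzOnWith_of_compact
    ((isCompact_uIcc (a := a) (b := b)).image hγ.continuous) hlip.locallyLipschitzOn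
  refine AbsolutelyContinuousOnInterval.of_dist_le K.coe_nonneg
    ((hInt a b).absolutelyContinuousOnInterval_intervalIntegral Set.left_mem_uIcc)
    fun s hs t ht => ?_
  refine (hK.dist_le_mul _ (Set.mem_image_of_mem _ hs) _ (Set.mem_image_of_mem _ ht)).trans ?_
  refine mul_le_mul_of_nonneg_left ?_ K.coe_nonneg
  have hd : IntervalIntegrable (deriv γ) volume t s :=
    (intervalIntegrable_iff.mpr ((integrable_norm_iff
      (measurable_deriv γ).aestronglyMeasurable).mp (intervalIntegrable_iff.mp (hInt t s))))
  rw [dist_eq_norm, Real.dist_eq, intervalIntegral.integral_interval_sub_left (hInt _ _) (hInt _ _),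
    ← intervalIntegral.integral_deriv_eq_sub (fun r _ => hγ r) hd]
  exact intervalIntegral.norm_integral_le_abs_integral_norm

theorem Calibrates.abs_sub_le_integral {d : ℕ} {W φ : (Fin d → ℝ) → ℝ}
    (hW0 : ∀ z, 0 ≤ W z) (hlip : LocallyLipschitz φ) (hφ : Calibrates W φ) {γ : ℝ → Fin d → ℝ}
    (hγ : Differentiable ℝ γ) (hE : Integrable (curveDensity W γ)) {a b : ℝ} (hab : a ≤ b) :
    |φ (γ b) - φ (γ a)| ≤ ∫ t in Set.Ioc a b, curveDensity W γ t := by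
  rw [← intervalIntegral.integral_of_le hab]
  exact hφ.abs_sub_le hab (absolutelyContinuousOnInterval_of_curveDensity hW0 hlip hγ hE a b)
    (Eventually.of_forall hγ) hE.intervalIntegrable
    (Eventually.of_forall fun t _ => sqrt_mul_sqrt_le_curveDensity hW0 γ t)

theorem Calibrates.abs_sub_le_integral_univ {d : ℕ} {W φ : (Fin d → ℝ) → ℝ}
    (hW0 : ∀ z, 0 ≤ W z) (hlip : LocallyLipschitz φ) (hφ : Calibrates W φ) {γ : ℝ → Fin d → ℝ}
    (hγ : Differentiable ℝ γ) (hE : Integrable (curveDensity W γ)) (a b : ℝ) :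
    |φ (γ b) - φ (γ a)| ≤ ∫ t, curveDensity W γ t := by
  have key : ∀ {a b : ℝ}, a ≤ b → |φ (γ b) - φ (γ a)| ≤ ∫ t, curveDensity W γ t := fun hab =>
    (hφ.abs_sub_le_integral hW0 hlip hγ hE hab).trans
      (setIntegral_le_integral hE (Eventually.of_forall (curveDensity_nonneg hW0 γ)))
  rcases le_total a b with h | h
  · exact key h
  · rw [abs_sub_comm]; exact key h

theorem exists_pos_le_of_eq_const {d : ℕ} {f : (Fin d → ℝ) → ℝ} (hf : Continuous f) {ρ c : ℝ}
    (hc : 0 < c) (hfc : ∀ z, ρ ≤ ‖z‖ → f z = c) {U : Set (Fin d → ℝ)} (hU : IsOpen U)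
    (hpos : ∀ z ∉ U, 0 < f z) : ∃ m > 0, ∀ z ∉ U, m ≤ f z := by
  have hK : IsCompact (Metric.closedBall (0 : Fin d → ℝ) ρ \ U) :=
    (isCompact_closedBall _ _).diff hU
  obtain ⟨m, hm, hmf⟩ := hK.exists_forall_le' hf.continuousOn (a := 0) fun z hz => hpos z hz.2
  refine ⟨min m c, lt_min hm hc, fun z hz => ?_⟩
  rcases le_total ρ ‖z‖ with h | h
  · rw [hfc z h]; exact min_le_right _ _
  · exact (min_le_left _ _).trans (hmf z ⟨by simpa using h, hz⟩)

/-- A potential whose zeros are the points `p i`, calibrated by functions `φ i` measuring the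
distance `δ` to the wells, both constant near infinity. -/
structure IsCalibrated {d : ℕ} (p : Fin (d + 1) → Fin d → ℝ) (δ : Fin (d + 1) → Fin (d + 1) → ℝ)
    (W : (Fin d → ℝ) → ℝ) (φ : Fin (d + 1) → (Fin d → ℝ) → ℝ) (ρ c : ℝ) : Prop where
  rho_pos : 0 < ρ
  c_pos : 0 < c
  continuous : Continuous W
  nonneg : ∀ z, 0 ≤ W z
  eq_one : ∀ z, ρ ≤ ‖z‖ → W z = 1
  calib_eq : ∀ z, ρ ≤ ‖z‖ → ∀ i, φ i z = c
  eq_zero_iff : ∀ z, W z = 0 ↔ ∃ i, z = p i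
  lipschitz : ∀ i, LocallyLipschitz (φ i)
  calibrates : ∀ i, Calibrates W (φ i)
  calib_apply : ∀ i j, φ i (p j) = δ i j
  calib_self : ∀ i, φ i (p i) = 0
  calib_nonneg : ∀ i z, 0 ≤ φ i z
  calib_eq_zero : ∀ i z, φ i z = 0 → z = p i

namespace IsCalibrated

variable {d : ℕ} {p : Fin (d + 1) → Fin d → ℝ} {δ : Fin (d + 1) → Fin (d + 1) → ℝ}
  {W : (Fin d → ℝ) → ℝ} {φ : Fin (d + 1) → (Fin d → ℝ) → ℝ} {ρ c : ℝ} {γ : ℝ → Fin d → ℝ}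

theorem tendsto_atTop (h : IsCalibrated p δ W φ ρ c) (hγ : Differentiable ℝ γ)
    (hE : Integrable (curveDensity W γ)) : ∃ j, Tendsto γ atTop (𝓝 (p j)) := by
  have hfreq : ∃ j, ∀ ε > 0, ∀ T : ℝ, ∃ s ≥ T, φ j (γ s) < ε := by
    by_contra! hcon
    choose ε hε T hT using hcon
    have hU : IsOpen {z | ∃ j, φ j z < ε j} := by
      simp only [Set.ofPred_exists]
      exact isOpen_iUnion fun j => isOpen_lt (h.lipschitz j).continuous continuous_const
    obtain ⟨m, hm, hmW⟩ := exists_pos_le_of_eq_const h.continuous one_pos h.eq_one hU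
      fun z hz => by
        refine (h.nonneg z).lt_of_ne' fun h0 => hz ?_
        obtain ⟨j, rfl⟩ := (h.eq_zero_iff z).mp h0
        exact ⟨j, by rw [h.calib_self]; exact hε j⟩
    obtain ⟨T', -, hT'⟩ := exists_forall_le T
    have h1 : IntegrableOn (fun _ : ℝ => m) (Set.Ioi T') := by
      refine Integrable.mono' (hE.integrableOn (s := Set.Ioi T')) aestronglyMeasurable_const ?_
      filter_upwards [ae_restrict_mem measurableSet_Ioi] with t ht
      rw [Real.norm_of_nonneg hm.le]
      have h2 := hmW (γ t) fun ⟨j, hj⟩ =>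
        absurd hj (not_lt.mpr (hT j t ((hT' j).trans (le_of_lt ht))))
      have h3 := vnorm2_nonneg (deriv γ t)
      rw [curveDensity]
      linarith
    rw [integrableOn_const_iff] at h1
    simp [hm.ne'] at h1
  obtain ⟨j, hj⟩ := hfreq
  have hlim : Tendsto (fun t => φ j (γ t)) atTop (𝓝 0) := by
    rw [tendsto_order]
    refine ⟨fun a ha => Eventually.of_forall fun t => ha.trans_le (h.calib_nonneg _ _),
      fun ε hε => ?_⟩
    have htail := (tendsto_integral_Ioi_zero (f := curveDensity W γ) (μ := volume)
      (l := atTop) tendsto_id).eventually_lt_const (half_pos hε)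
    obtain ⟨T, hT⟩ := eventually_atTop.mp htail
    obtain ⟨s, hs, hsε⟩ := hj (ε / 2) (half_pos hε) T
    filter_upwards [eventually_ge_atTop s] with t ht
    have h1 := (h.calibrates j).abs_sub_le_integral h.nonneg (h.lipschitz j) hγ hE ht
    have h2 : ∫ r in Set.Ioc s t, curveDensity W γ r ≤ ∫ r in Set.Ioi s, curveDensity W γ r :=
      setIntegral_mono_set hE.integrableOn
        (Eventually.of_forall (curveDensity_nonneg h.nonneg γ))
        (Set.Ioc_subset_Ioi_self).eventuallyLE
    have h3 := hT s hs
    have h4 := le_abs_self (φ j (γ t) - φ j (γ s))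
    simp only [id] at h3
    linarith
  refine ⟨j, tendsto_nhds.mpr fun U hU hpU => ?_⟩
  obtain ⟨m, hm, hmφ⟩ := exists_pos_le_of_eq_const (h.lipschitz j).continuous h.c_pos
    (fun z hz => h.calib_eq z hz j) hU fun z hz => (h.calib_nonneg j z).lt_of_ne' fun h0 =>
      hz (h.calib_eq_zero j z h0 ▸ hpU)
  filter_upwards [hlim.eventually_lt_const hm] with t ht
  by_contra hcon
  exact absurd ht (not_lt.mpr (hmφ _ hcon))

theorem curveDensity_comp_neg (W : (Fin d → ℝ) → ℝ) (γ : ℝ → Fin d → ℝ) (t : ℝ) :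
    curveDensity W (fun s => γ (-s)) t = curveDensity W γ (-t) := by
  simp [curveDensity, deriv_comp_neg, vnorm2]

theorem tendsto_atBot (h : IsCalibrated p δ W φ ρ c) (hγ : Differentiable ℝ γ)
    (hE : Integrable (curveDensity W γ)) : ∃ j, Tendsto γ atBot (𝓝 (p j)) := by
  obtain ⟨j, hj⟩ := h.tendsto_atTop (γ := fun s => γ (-s)) (hγ.comp differentiable_neg)
    (by simpa only [funext (curveDensity_comp_neg W γ)] using hE.comp_neg)
  exact ⟨j, by simpa [Function.comp_def] using hj.comp tendsto_neg_atBot_atTop⟩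

theorem le_integral (h : IsCalibrated p δ W φ ρ c) (hγ : Differentiable ℝ γ)
    (hE : Integrable (curveDensity W γ)) {i j : Fin (d + 1)} (hi : Tendsto γ atBot (𝓝 (p i)))
    (hj : Tendsto γ atTop (𝓝 (p j))) : δ i j ≤ ∫ t, curveDensity W γ t := by
  have hc := (h.lipschitz i).continuous
  have h1 : ∀ b, φ i (γ b) ≤ ∫ t, curveDensity W γ t := fun b => by
    have h2 : Tendsto (fun a => φ i (γ b) - φ i (γ a)) atBot (𝓝 (φ i (γ b) - φ i (p i))) :=
      tendsto_const_nhds.sub ((hc.tendsto _).comp hi)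
    rw [h.calib_self, sub_zero] at h2
    exact le_of_tendsto h2 (Eventually.of_forall fun a => (le_abs_self _).trans
      ((h.calibrates i).abs_sub_le_integral_univ h.nonneg (h.lipschitz i) hγ hE a b))
  rw [← h.calib_apply]
  exact le_of_tendsto ((hc.tendsto _).comp hj) (Eventually.of_forall h1)

/-- The distance of a coordinate to `[-ρ, ρ]` is calibrated. -/
theorem calibrates_max_abs (h : IsCalibrated p δ W φ ρ c) (l : Fin d) :
    Calibrates W fun z => max |z l| ρ := by
  intro γ t γ' D hγ hD
  have hl : HasDerivAt (fun s => γ s l) (γ' l) t := (hasDerivAt_pi.mp hγ) l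
  have hright : ρ ≤ |γ t l| → |γ' l| ≤ Real.sqrt (2 * W (γ t)) * Real.sqrt (vnorm2 γ') := by
    intro hρ
    rw [h.eq_one _ (hρ.trans (by simpa using norm_le_pi_norm (γ t) l))]
    have h1 : |γ' l| ≤ Real.sqrt (vnorm2 γ') := Real.abs_le_sqrt (sq_le_vnorm2 γ' l)
    have h2 : 1 ≤ Real.sqrt (2 * 1) := Real.one_le_sqrt.mpr (by norm_num)
    nlinarith [Real.sqrt_nonneg (vnorm2 γ')]
  rcases lt_or_ge |γ t l| ρ with hlt | hge
  · have h1 : (fun s => max |γ s l| ρ) =ᶠ[𝓝 t] fun _ => ρ := by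
      filter_upwards [hl.continuousAt.abs.eventually_lt_const hlt] with s hs
      exact max_eq_right hs.le
    rw [hD.unique ((hasDerivAt_const t ρ).congr_of_eventuallyEq h1), abs_zero]
    positivity
  · rcases le_total 0 (γ t l) with h0 | h0
    · have hmin : IsLocalMin (fun s => max |γ s l| ρ - γ s l) t := by
        refine Eventually.of_forall fun s => ?_
        beta_reduce
        rw [max_eq_left hge, abs_of_nonneg h0, sub_self]
        linarith [le_max_left |γ s l| ρ, le_abs_self (γ s l)]
      have := hmin.hasDerivAt_eq_zero (hD.sub hl)
      rw [show D = γ' l by linarith]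
      exact hright hge
    · have hmin : IsLocalMin (fun s => max |γ s l| ρ + γ s l) t := by
        refine Eventually.of_forall fun s => ?_
        beta_reduce
        rw [max_eq_left hge, abs_of_nonpos h0, neg_add_cancel]
        linarith [le_max_left |γ s l| ρ, neg_abs_le (γ s l)]
      have := hmin.hasDerivAt_eq_zero (hD.add hl)
      rw [show D = -γ' l by linarith, abs_neg]
      exact hright hge

theorem norm_le_add_integral (h : IsCalibrated p δ W φ ρ c) (hγ : Differentiable ℝ γ)
    (hE : Integrable (curveDensity W γ)) (t : ℝ) :
    ‖γ t‖ ≤ ρ + ∑ j, ‖p j‖ + ∫ s, curveDensity W γ s := by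
  obtain ⟨j, hj⟩ := h.tendsto_atTop hγ hE
  have hj' := Finset.single_le_sum (f := fun j => ‖p j‖) (fun _ _ => norm_nonneg _)
    (Finset.mem_univ j)
  have hI : 0 ≤ ∫ s, curveDensity W γ s := integral_nonneg (curveDensity_nonneg h.nonneg γ)
  have hρ := h.rho_pos
  refine (pi_norm_le_iff_of_nonneg (by positivity)).mpr fun l => ?_
  have hlip : LocallyLipschitz fun z : Fin d → ℝ => max |z l| ρ := by
    refine LipschitzWith.locallyLipschitz (K := 1) (LipschitzWith.of_dist_le_mul fun x y => ?_)
    rw [NNReal.coe_one, one_mul, Real.dist_eq]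
    refine (abs_max_sub_max_le_abs _ _ _).trans ((abs_abs_sub_abs_le_abs_sub _ _).trans ?_)
    simpa [Real.dist_eq] using dist_le_pi_dist x y l
  have hlim : Tendsto (fun s => max |γ t l| ρ - max |γ s l| ρ) atTop
      (𝓝 (max |γ t l| ρ - max |p j l| ρ)) :=
    tendsto_const_nhds.sub ((hlip.continuous.tendsto _).comp hj)
  have h1 := le_of_tendsto hlim (Eventually.of_forall fun s => (le_abs_self _).trans
    ((h.calibrates_max_abs l).abs_sub_le_integral_univ h.nonneg hlip hγ hE s t))
  have h2 := le_max_left |γ t l| ρ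
  have h3 : max |p j l| ρ ≤ ‖p j‖ + ρ :=
    max_le (by linarith [Real.norm_eq_abs (p j l) ▸ norm_le_pi_norm (p j) l]) (by
      linarith [norm_nonneg (p j)])
  rw [Real.norm_eq_abs]
  linarith

end IsCalibrated

/-! ### Minimizers -/

theorem ae_tendsto_of_tendsto_integral {d : ℕ} {p : Fin (d + 1) → Fin d → ℝ}
    (hp : AffineIndependent ℝ p) {Y : Type*} [MeasurableSpace Y] {μ : Measure Y}
    [IsProbabilityMeasure μ] {l : Filter ℝ} [l.IsCountablyGenerated] [l.NeBot]
    {w : Y → ℝ → Fin d → ℝ} (hw : ∀ t, AEStronglyMeasurable (fun y => w y t) μ) {b : Y → ℝ}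
    (hb : Integrable b μ) (hwb : ∀ᵐ y ∂μ, ∀ t, ‖w y t‖ ≤ b y)
    (hlim : ∀ᵐ y ∂μ, ∃ j, Tendsto (w y) l (𝓝 (p j))) {i : Fin (d + 1)}
    (hi : Tendsto (fun t => ∫ y, w y t ∂μ) l (𝓝 (p i))) :
    ∀ᵐ y ∂μ, Tendsto (w y) l (𝓝 (p i)) := by
  classical
  obtain ⟨c, hc, -⟩ := exists_barycentric hp
  let J : Y → Fin (d + 1) := fun y =>
    if h : ∃ j, Tendsto (w y) l (𝓝 (p j)) then h.choose else i
  have hJ : ∀ᵐ y ∂μ, Tendsto (w y) l (𝓝 (p (J y))) := by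
    filter_upwards [hlim] with y hy
    simp only [J, dif_pos hy]
    exact hy.choose_spec
  have hInt : ∫ y, p (J y) ∂μ = p i :=
    tendsto_nhds_unique (tendsto_integral_filter_of_dominated_convergence b
      (Eventually.of_forall hw) (Eventually.of_forall fun t => hwb.mono fun y hy => hy t) hb hJ) hi
  have hJm : AEStronglyMeasurable (fun y => p (J y)) μ := aestronglyMeasurable_of_tendsto_ae l hw hJ
  have hJi : Integrable (fun y => p (J y)) μ :=
    hb.mono' hJm (by
      filter_upwards [hwb, hJ] with y h1 h2
      exact le_of_tendsto h2.norm (Eventually.of_forall h1))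
  obtain ⟨L, a, hcL⟩ : ∃ (L : (Fin d → ℝ) →L[ℝ] ℝ) (a : ℝ), ∀ z, c i z = L z + a :=
    ⟨LinearMap.toContinuousLinearMap (c i).linear, c i 0, fun z => by
      simpa using congrFun (c i).decomp z⟩
  have hci : Integrable (fun y => c i (p (J y))) μ := by
    simp_rw [hcL]
    exact ((ContinuousLinearMap.integrable_comp _ hJi).add (integrable_const _))
  have h1 : ∫ y, (1 - c i (p (J y))) ∂μ = 0 := by
    rw [integral_sub (integrable_const _) hci]
    have : ∫ y, c i (p (J y)) ∂μ = c i (p i) := by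
      rw [hcL (p i), ← hInt, ← ContinuousLinearMap.integral_comp_comm _ hJi]
      simp_rw [hcL]
      rw [integral_add (ContinuousLinearMap.integrable_comp _ hJi) (integrable_const _)]
      simp
    rw [this, hc, if_pos rfl]
    simp
  have h2 := (integral_eq_zero_iff_of_nonneg (fun y => by
    change 0 ≤ 1 - c i (p (J y))
    rw [hc]; split_ifs <;> norm_num) ((integrable_const _).sub hci)).mp h1
  filter_upwards [h2, hJ] with y h3 h4
  have h5 : J y = i := by
    by_contra hne
    simp [hc, Ne.symm hne] at h3
  rwa [h5] at h4

section Slices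

variable {d : ℕ} [NeZero d] {W : (Fin d → ℝ) → ℝ} {R : Matrix (Fin d) (Fin d) ℝ}
  {ν : Fin d → ℝ} {u : (Fin d → ℝ) → Fin d → ℝ}

theorem measurable_transpose_mulVec_update (R : Matrix (Fin d) (Fin d) ℝ) :
    Measurable fun q : (Fin d → ℝ) × ℝ => R.transpose.mulVec (Function.update q.1 0 q.2) :=
  (Continuous.matrix_mulVec continuous_const continuous_id).measurable.comp measurable_update'

theorem hasDerivAt_slice (hR : R.transpose * R = 1) (hν : R.mulVec ν = Pi.single 0 1)
    (hu : Differentiable ℝ u) (y : Fin d → ℝ) (t : ℝ) :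
    HasDerivAt (fun t => u (R.transpose.mulVec (Function.update y 0 t)))
      (fderiv ℝ u (R.transpose.mulVec (Function.update y 0 t)) ν) t := by
  refine (hu _).hasFDerivAt.comp_hasDerivAt t ?_
  rw [funext (transpose_mulVec_update hR hν y)]
  simpa using (hasDerivAt_id t).smul_const ν

theorem energyR_eq_slices_add (hR : R.transpose * R = 1) (hdet : R.det = 1)
    (hν : R.mulVec ν = Pi.single 0 1) (hW : Continuous W) (hW0 : ∀ z, 0 ≤ W z)
    (hu : Differentiable ℝ u) :
    Measurable (fun y => ∫⁻ t, ENNReal.ofReal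
      (curveDensity W (fun t => u (R.transpose.mulVec (Function.update y 0 t))) t)) ∧
    energyR d W R u = (∫⁻ y in cube d, ∫⁻ t, ENNReal.ofReal
      (curveDensity W (fun t => u (R.transpose.mulVec (Function.update y 0 t))) t)) +
      ∫⁻ x in stripR d R, ENNReal.ofReal (1 / 2 * ∑ k ∈ Finset.univ.erase 0,
        vnorm2 (fderiv ℝ u x (R.transpose.mulVec (Pi.single k 1)))) := by
  have hm : Measurable fun x => ENNReal.ofReal (1 / 2 * vnorm2 (fderiv ℝ u x ν) + W (u x)) :=
    (((continuous_vnorm2.measurable.comp (measurable_fderiv_apply_const ℝ u ν)).const_mul _).add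
      (hW.comp hu.continuous).measurable).ennreal_ofReal
  have hcurve : ∀ y t, curveDensity W (fun t => u (R.transpose.mulVec (Function.update y 0 t))) t
      = 1 / 2 * vnorm2 (fderiv ℝ u (R.transpose.mulVec (Function.update y 0 t)) ν)
        + W (u (R.transpose.mulVec (Function.update y 0 t))) := fun y t => by
    rw [curveDensity, (hasDerivAt_slice hR hν hu y t).deriv]
  simp_rw [hcurve]
  refine ⟨(hm.comp (measurable_transpose_mulVec_update R)).lintegral_prod_right', ?_⟩
  rw [← lintegral_stripR hR hdet hm, ← lintegral_add_left hm, energyR]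
  refine lintegral_congr fun x => ?_
  rw [← ENNReal.ofReal_add, eden, gradSq_eq_sum_rotated hR,
    ← Finset.add_sum_erase _ _ (Finset.mem_univ 0), transpose_mulVec_single_zero hR hν]
  · congr 1; ring
  · exact add_nonneg (mul_nonneg (by norm_num) (vnorm2_nonneg _)) (hW0 _)
  · exact mul_nonneg (by norm_num) (Finset.sum_nonneg fun _ _ => vnorm2_nonneg _)

end Slices

theorem IsCalibrated.eq_profile_of_energyR_le {d : ℕ} [NeZero d] {p : Fin (d + 1) → Fin d → ℝ}
    {δ : Fin (d + 1) → Fin (d + 1) → ℝ} {W : (Fin d → ℝ) → ℝ}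
    {φ : Fin (d + 1) → (Fin d → ℝ) → ℝ} {ρ c : ℝ} (h : IsCalibrated p δ W φ ρ c)
    (hp : AffineIndependent ℝ p) {R : Matrix (Fin d) (Fin d) ℝ} {ν : Fin d → ℝ}
    (hR : R.transpose * R = 1) (hdet : R.det = 1) (hν : R.mulVec ν = Pi.single 0 1)
    {u : (Fin d → ℝ) → Fin d → ℝ} (hu : Differentiable ℝ u) (hper : IsPeriodicR d R u)
    {im ip : Fin (d + 1)} (hbot : Tendsto (avgR d R u) atBot (𝓝 (p im)))
    (htop : Tendsto (avgR d R u) atTop (𝓝 (p ip)))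
    (hE : energyR d W R u ≤ ENNReal.ofReal (δ im ip)) :
    ∃ g : ℝ → Fin d → ℝ, Differentiable ℝ g ∧ (∀ x, u x = g (x ⬝ᵥ ν)) ∧
      Tendsto g atBot (𝓝 (p im)) ∧ Tendsto g atTop (𝓝 (p ip)) ∧
      energyR d W R u = ENNReal.ofReal (δ im ip) := by
  obtain ⟨hm, hsplit⟩ := energyR_eq_slices_add hR hdet hν h.continuous h.nonneg hu
  set w : (Fin d → ℝ) → ℝ → Fin d → ℝ :=
    fun y t => u (R.transpose.mulVec (Function.update y 0 t)) with hw
  have hwd : ∀ y, Differentiable ℝ (w y) := fun y t =>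
    (hasDerivAt_slice hR hν hu y t).differentiableAt
  set T : ℝ≥0∞ := ∫⁻ x in stripR d R, ENNReal.ofReal (1 / 2 * ∑ k ∈ Finset.univ.erase 0,
    vnorm2 (fderiv ℝ u x (R.transpose.mulVec (Pi.single k 1)))) with hT
  set A : ℝ≥0∞ := ∫⁻ y in cube d, ∫⁻ t, ENNReal.ofReal (curveDensity W (w y) t) with hA
  have hAT : A + T ≤ ENNReal.ofReal (δ im ip) := hsplit ▸ hE
  have hAtop : A ≠ ∞ := ne_top_of_le_ne_top ENNReal.ofReal_ne_top (le_self_add.trans hAT)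
  have hdm : ∀ y, Measurable (curveDensity W (w y)) := fun y =>
    ((continuous_vnorm2.measurable.comp (measurable_deriv (w y))).const_mul _).add
      (h.continuous.comp (hwd y).continuous).measurable
  have hslice : ∀ᵐ y ∂volume.restrict (cube d), Integrable (curveDensity W (w y)) := by
    filter_upwards [ae_lt_top hm hAtop] with y hy
    refine ⟨(hdm y).aestronglyMeasurable, ?_⟩
    rwa [hasFiniteIntegral_iff_ofReal (Eventually.of_forall (curveDensity_nonneg h.nonneg (w y)))]
  have hbound : ∀ᵐ y ∂volume.restrict (cube d), ∀ t, ‖w y t‖ ≤ ρ + ∑ j, ‖p j‖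
      + (∫⁻ t, ENNReal.ofReal (curveDensity W (w y) t)).toReal := by
    filter_upwards [hslice] with y hy t
    rw [← integral_eq_lintegral_of_nonneg_ae
      (Eventually.of_forall (curveDensity_nonneg h.nonneg (w y))) hy.aestronglyMeasurable]
    exact h.norm_le_add_integral (hwd y) hy t
  have hbi : Integrable (fun y => ρ + ∑ j, ‖p j‖
      + (∫⁻ t, ENNReal.ofReal (curveDensity W (w y) t)).toReal) (volume.restrict (cube d)) :=
    (integrable_const _).add (integrable_toReal_of_lintegral_ne_top hm.aemeasurable hAtop)
  have hwm : ∀ t, AEStronglyMeasurable (fun y => w y t) (volume.restrict (cube d)) := fun t =>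
    (hu.continuous.measurable.comp ((measurable_transpose_mulVec_update R).comp
      (measurable_id.prodMk measurable_const))).aestronglyMeasurable
  have hwbot := ae_tendsto_of_tendsto_integral hp hwm hbi hbound
    (hslice.mono fun y hy => h.tendsto_atBot (hwd y) hy) hbot
  have hwtop := ae_tendsto_of_tendsto_integral hp hwm hbi hbound
    (hslice.mono fun y hy => h.tendsto_atTop (hwd y) hy) htop
  have hAge : ENNReal.ofReal (δ im ip) ≤ A := by
    calc ENNReal.ofReal (δ im ip) = ∫⁻ _ in cube d, ENNReal.ofReal (δ im ip) := by
          rw [lintegral_const]; simp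
      _ ≤ A := by
          refine lintegral_mono_ae ?_
          filter_upwards [hslice, hwbot, hwtop] with y h1 h2 h3
          rw [← ofReal_integral_eq_lintegral_ofReal h1
            (Eventually.of_forall (curveDensity_nonneg h.nonneg (w y)))]
          exact ENNReal.ofReal_le_ofReal (h.le_integral (hwd y) h1 h2 h3)
  have hEeq : energyR d W R u = ENNReal.ofReal (δ im ip) :=
    le_antisymm hE (hsplit ▸ hAge.trans le_self_add)
  have hT0 : T = 0 := by
    have h1 : A + T ≤ A + 0 := by rw [add_zero]; exact hAT.trans hAge
    exact le_antisymm ((ENNReal.add_le_add_iff_left hAtop).mp h1) zero_le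
  have htrans : ∀ k : Fin d, k ≠ 0 → ∀ᵐ x ∂volume.restrict (stripR d R),
      fderiv ℝ u x (R.transpose.mulVec (Pi.single k 1)) = 0 := by
    intro k hk
    have hTm : Measurable fun x => ENNReal.ofReal (1 / 2 * ∑ k ∈ Finset.univ.erase 0,
        vnorm2 (fderiv ℝ u x (R.transpose.mulVec (Pi.single k 1)))) :=
      (Measurable.const_mul (Finset.measurable_sum _ fun k _ => continuous_vnorm2.measurable.comp
        (measurable_fderiv_apply_const ℝ u _)) _).ennreal_ofReal
    filter_upwards [(lintegral_eq_zero_iff hTm).mp hT0] with x hx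
    have h1 := ENNReal.ofReal_eq_zero.mp hx
    have h2 := Finset.single_le_sum
      (f := fun k => vnorm2 (fderiv ℝ u x (R.transpose.mulVec (Pi.single k 1))))
      (fun _ _ => vnorm2_nonneg _) (Finset.mem_erase.mpr ⟨hk, Finset.mem_univ k⟩)
    exact vnorm2_eq_zero.mp (le_antisymm (by linarith) (vnorm2_nonneg _))
  have hprof := eq_profile_of_fderiv_eq_zero hR hν hu hper htrans
  obtain ⟨y, hy1, hy2⟩ := (hwbot.and hwtop).exists
  have hwy : w y = fun t => u (t • ν) := by
    ext1 t
    refine (hprof _).trans ?_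
    rw [transpose_mulVec_dotProduct hν, Function.update_self]
  rw [hwy] at hy1 hy2
  exact ⟨fun t => u (t • ν), hu.comp (differentiable_id.smul_const ν), hprof, hy1, hy2, hEeq⟩

/-- Theorem `thm:finite_wells`: given an affine basis `X = {x₀,…,x_d}` of
`ℝ^d` and a metric `δ` on `X`, there is a Lipschitz potential `W ≥ 0` with `W = 1` at
infinity, zero set exactly `X`, `geod_W = δ` on `X × X`, and such that for any two wells and
any admissible transition direction `ν` (with rotation `R ∈ SO(d)`, `Rν = e₁`), every global
minimizer of `E_R` with the rotated boundary conditions is one-dimensional with energy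
`δ(u⁻,u⁺)`. -/
theorem statement9 (d : ℕ) [NeZero d] (hd : 2 ≤ d)
    (p : Fin (d + 1) → Fin d → ℝ) (hp : AffineIndependent ℝ p)
    (δ : Fin (d + 1) → Fin (d + 1) → ℝ)
    (hδ0 : ∀ i, δ i i = 0) (hδpos : ∀ i j, i ≠ j → 0 < δ i j)
    (hδsymm : ∀ i j, δ i j = δ j i) (hδtri : ∀ i j k, δ i j ≤ δ i k + δ k j) :
    ∃ W : (Fin d → ℝ) → ℝ,
      (∃ K : NNReal, LipschitzWith K W) ∧ (∀ z, 0 ≤ W z) ∧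
      (∃ ρ : ℝ, ∀ z : Fin d → ℝ, ρ ≤ Real.sqrt (vnorm2 z) → W z = 1) ∧
      (∀ z, W z = 0 ↔ ∃ i, z = p i) ∧
      (∀ i j, geodFull d W (p i) (p j) = δ i j) ∧
      (∀ (im ip : Fin (d + 1)) (ν : Fin d → ℝ) (R : Matrix (Fin d) (Fin d) ℝ),
        vnorm2 ν = 1 → (∑ k, ν k * (p ip k - p im k)) = 0 →
        R.transpose * R = 1 → R.det = 1 → R.mulVec ν = Pi.single 0 1 →
        ∀ u : (Fin d → ℝ) → Fin d → ℝ, AdmR d R u →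
          Tendsto (avgR d R u) atBot (𝓝 (p im)) → Tendsto (avgR d R u) atTop (𝓝 (p ip)) →
          (∀ v, AdmR d R v → Tendsto (avgR d R v) atBot (𝓝 (p im)) →
            Tendsto (avgR d R v) atTop (𝓝 (p ip)) → energyR d W R u ≤ energyR d W R v) →
          ∃ g : ℝ → Fin d → ℝ, Differentiable ℝ g ∧
            (∀ x, u x = g (∑ k, x k * ν k)) ∧
            Tendsto g atBot (𝓝 (p im)) ∧ Tendsto g atTop (𝓝 (p ip)) ∧
            energyR d W R u = ENNReal.ofReal (δ im ip)) := by
  obtain ⟨W, φ, ρ, c, hρ, hc, hLip, hW0, hfar, hzero, hedge, hlip, hcal, happ, hφ0, hφz⟩ :=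
    exists_calibrated_potential hp hδ0 hδpos hδsymm hδtri
  have hWc : Continuous W := hLip.choose_spec.continuous
  have h : IsCalibrated p δ W φ ρ c :=
    ⟨hρ, hc, hWc, hW0, fun z hz => (hfar z hz).1, fun z hz => (hfar z hz).2, hzero, hlip, hcal,
      happ, fun i => by rw [happ, hδ0], hφ0, hφz⟩
  have hd0 : 0 < √(d : ℝ) := Real.sqrt_pos.2 (by exact_mod_cast (by omega : 0 < d))
  refine ⟨W, hLip, hW0, ⟨√(d : ℝ) * ρ, fun z hz => h.eq_one z
    (le_of_mul_le_mul_left (hz.trans (sqrt_vnorm2_le z)) hd0)⟩, hzero, fun i j => ?_, ?_⟩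
  · by_cases hij : i = j
    · rw [hij, geodFull_self, hδ0]
    · refine geodFull_eq hWc (hlip i) (hcal i) (hp.injective.ne hij) (hδpos i j hij).le
        (hedge i j hij) ?_
      rw [happ, happ, hδ0, sub_zero, abs_of_pos (hδpos i j hij)]
  · intro im ip ν R hν1 hνab hR hdet hν u hu hbot htop hmin
    have hle : energyR d W R u ≤ ENNReal.ofReal (δ im ip) := by
      by_cases hii : im = ip
      · subst hii
        obtain ⟨v, hv, hv1, hv2, hvE⟩ := exists_competitor_self hR hdet hν hν1 hWc hW0
          ((hzero (p im)).2 ⟨im, rfl⟩)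
        exact (hmin v hv hv1 hv2).trans (hvE.le.trans zero_le)
      · obtain ⟨v, hv, hv1, hv2, hvE⟩ := exists_competitor hR hdet hν hν1 hWc hW0
          (hp.injective.ne hii) (hδpos im ip hii) hνab (hedge im ip hii)
        exact (hmin v hv hv1 hv2).trans hvE.le
    exact h.eq_profile_of_energyR_le hp hR hdet hν hu.1 hu.2.1 hbot htop hle
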